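/- arXiv:2309.09757 — 2 statements merged into one kernel-verified Lean document; each statement's English description precedes it below -/
import Mathlib

section
/- Let M ⊂ ℂⁿ be a smooth pseudoconvex real hypersurface with defining function ρ, let p ∈ M, and let L₁,…,L_s be smooth CR vector fields along M whose values at every point are ℂ-linearly independent, spanning a rank-s subbundle B of T^{1,0}M. Then the minimum, over smooth sections L = Σ_j a_j L_j of B with L(p) ≠ 0, of ν_B(λ(L,L))(p) equals ν_B(tr_{V_B} λ)(p), where tr_{V_B} λ = Σ_{j=1}^s λ(L_j, L_j) is the trace of the Levi form along the frame V_B = {L₁,…,L_s}. -/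
open Topology

/-- ℂⁿ as a Pi type. -/
abbrev Cn (n : ℕ) := Fin n → ℂ

/-- The Wirtinger derivative `∂f/∂z_j` of a (real-)smooth function `f : ℂⁿ → ℂ`. -/
noncomputable def wz {n : ℕ} (j : Fin n) (f : Cn n → ℂ) (x : Cn n) : ℂ :=
  (fderiv ℝ f x (Pi.single j 1) - Complex.I * fderiv ℝ f x (Pi.single j Complex.I)) / 2

/-- The Wirtinger derivative `∂f/∂z̄_j` of a (real-)smooth function `f : ℂⁿ → ℂ`. -/
noncomputable def wzb {n : ℕ} (j : Fin n) (f : Cn n → ℂ) (x : Cn n) : ℂ :=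
  (fderiv ℝ f x (Pi.single j 1) + Complex.I * fderiv ℝ f x (Pi.single j Complex.I)) / 2

/-- The complexification of a real-valued function on ℂⁿ. -/
def cx {n : ℕ} (ρ : Cn n → ℝ) : Cn n → ℂ := fun x => (ρ x : ℂ)

/-- A complex vector field of mixed type `(1,0) + (0,1)` on ℂⁿ:
`W = Σ_j hol_j ∂/∂z_j + Σ_j anti_j ∂/∂z̄_j`. -/
structure CVF (n : ℕ) where
  hol : Fin n → Cn n → ℂ
  anti : Fin n → Cn n → ℂ

/-- Action of a mixed-type complex vector field on functions, as a derivation. -/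
noncomputable def CVF.act {n : ℕ} (W : CVF n) (f : Cn n → ℂ) : Cn n → ℂ :=
  fun x => (∑ j, W.hol j x * wz j f x) + (∑ j, W.anti j x * wzb j f x)

/-- Lie bracket of two mixed-type complex vector fields (with smooth coefficients the
commutator `[V,W]` of the first–order operators is again first order with these
coefficients). -/
noncomputable def CVF.bracket {n : ℕ} (V W : CVF n) : CVF n where
  hol := fun j x => V.act (W.hol j) x - W.act (V.hol j) x
  anti := fun j x => V.act (W.anti j) x - W.act (V.anti j) x

/-- The `(1,0)` vector field `L = Σ_j a_j ∂/∂z_j`. -/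
def LVF {n : ℕ} (a : Fin n → Cn n → ℂ) : CVF n := ⟨a, fun _ _ => 0⟩

/-- The conjugate `(0,1)` vector field `L̄ = Σ_j ā_j ∂/∂z̄_j`. -/
def LbarVF {n : ℕ} (a : Fin n → Cn n → ℂ) : CVF n :=
  ⟨fun _ _ => 0, fun j x => starRingEnd ℂ (a j x)⟩

/-- `a` is a smooth CR vector field along `M = {ρ = 0}`: smooth coefficients annihilating
`ρ` in the `(1,0)` directions, i.e. `Σ_j a_j ∂ρ/∂z_j = 0` on `M`. -/
def IsCRField {n : ℕ} (ρ : Cn n → ℝ) (M : Set (Cn n)) (a : Fin n → Cn n → ℂ) : Prop :=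
  (∀ j, ContDiff ℝ (⊤ : ℕ∞) (a j)) ∧ ∀ x ∈ M, ∑ j, a j x * wz j (cx ρ) x = 0

/-- Membership in the module `𝓜₁(L)` generated over smooth functions by `L` and `L̄`. -/
def InM1 {n : ℕ} (a : Fin n → Cn n → ℂ) (W : CVF n) : Prop :=
  ∃ c₁ c₂ : Cn n → ℂ, ContDiff ℝ (⊤ : ℕ∞) c₁ ∧ ContDiff ℝ (⊤ : ℕ∞) c₂ ∧
    (∀ j x, W.hol j x = c₁ x * a j x) ∧ (∀ j x, W.anti j x = c₂ x * starRingEnd ℂ (a j x))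

/-- `ν_L(f)(p)`: the smallest `m` such that `Y_m(⋯(Y_1 f)⋯)(p) ≠ 0` for some
`Y₁, …, Y_m ∈ 𝓜₁(L)`; `⊤` if no such `m` exists. -/
noncomputable def nuL {n : ℕ} (a : Fin n → Cn n → ℂ) (f : Cn n → ℂ) (p : Cn n) : ℕ∞ :=
  sInf {m : ℕ∞ | ∃ Ws : List (CVF n), (Ws.length : ℕ∞) = m ∧ (∀ W ∈ Ws, InM1 a W) ∧
    (Ws.foldl (fun g W => W.act g) f) p ≠ 0}

/-- The coefficient `∂²ρ/∂z_j ∂z̄_l` of the Levi form. -/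
noncomputable def leviCoeff {n : ℕ} (ρ : Cn n → ℝ) (j l : Fin n) (x : Cn n) : ℂ :=
  wz j (wzb l (cx ρ)) x

/-- The Levi form `λ(X,Y) = Σ_{j,l} (∂²ρ/∂z_j∂z̄_l) ξ_j η̄_l` of the fields with
coefficients `ξ`, `η`, as a function on ℂⁿ. -/
noncomputable def levi {n : ℕ} (ρ : Cn n → ℝ) (ξ η : Fin n → Cn n → ℂ) (x : Cn n) : ℂ :=
  ∑ j, ∑ l, leviCoeff ρ j l x * ξ j x * starRingEnd ℂ (η l x)

/-- `M = {ρ = 0}` is pseudoconvex: the Levi form is positive semi-definite on the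
CR directions at every point of `M`. -/
def Pseudoconvex {n : ℕ} (ρ : Cn n → ℝ) (M : Set (Cn n)) : Prop :=
  ∀ x ∈ M, ∀ ξ : Fin n → ℂ, (∑ j, ξ j * wz j (cx ρ) x) = 0 →
    0 ≤ (∑ j, ∑ l, leviCoeff ρ j l x * ξ j * starRingEnd ℂ (ξ l)).re

/-- Iterated commutators of length `μ` of elements of `𝓜₁(L)`:
`[Y_μ, [Y_{μ-1}, ⋯ [Y₂, Y₁]⋯]]` with each `Y_i ∈ 𝓜₁(L)`. -/
inductive IsCommOf {n : ℕ} (a : Fin n → Cn n → ℂ) : ℕ → CVF n → Prop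
  | one (W : CVF n) : InM1 a W → IsCommOf a 1 W
  | succ {μ : ℕ} (V W : CVF n) : InM1 a V → IsCommOf a μ W → IsCommOf a (μ + 1) (V.bracket W)

/-- The pairing `⟨∂ρ, G⟩(p)` of a mixed-type field with the `(1,0)` form `∂ρ`. -/
noncomputable def pairDRho {n : ℕ} (ρ : Cn n → ℝ) (G : CVF n) (p : Cn n) : ℂ :=
  ∑ j, G.hol j p * wz j (cx ρ) p

/-- The commutator type `t_L(M,p)`: the smallest `m` such that `⟨∂ρ, G⟩(p) ≠ 0` for some
iterated commutator `G` of length (at most) `m` of elements of `𝓜₁(L)`; `⊤` if none. -/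
noncomputable def tType {n : ℕ} (ρ : Cn n → ℝ) (a : Fin n → Cn n → ℂ) (p : Cn n) : ℕ∞ :=
  sInf {m : ℕ∞ | ∃ μ : ℕ, (μ : ℕ∞) = m ∧ ∃ G : CVF n, IsCommOf a μ G ∧ pairDRho ρ G p ≠ 0}

/-- The Levi-form type `c_L(M,p) = 2 + ν_L(λ(L,L))(p)`. -/
noncomputable def cType {n : ℕ} (ρ : Cn n → ℝ) (a : Fin n → Cn n → ℂ) (p : Cn n) : ℕ∞ :=
  2 + nuL a (levi ρ a a) p

/-- Membership in the module `𝓜₁(B)` generated over smooth functions by the frame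
`L₁, …, L_s` of `B` (with coefficient functions `A i`) and their conjugates. -/
def InM1B {n s : ℕ} (A : Fin s → Fin n → Cn n → ℂ) (W : CVF n) : Prop :=
  ∃ c d : Fin s → Cn n → ℂ,
    (∀ i, ContDiff ℝ (⊤ : ℕ∞) (c i)) ∧ (∀ i, ContDiff ℝ (⊤ : ℕ∞) (d i)) ∧
    (∀ j x, W.hol j x = ∑ i, c i x * A i j x) ∧
    (∀ j x, W.anti j x = ∑ i, d i x * starRingEnd ℂ (A i j x))

/-- `ν_B(f)(p)`: the smallest `m` such that `Y_m(⋯(Y_1 f)⋯)(p) ≠ 0` for some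
`Y₁, …, Y_m ∈ 𝓜₁(B)`; `⊤` if no such `m` exists. -/
noncomputable def nuB {n s : ℕ} (A : Fin s → Fin n → Cn n → ℂ) (f : Cn n → ℂ)
    (p : Cn n) : ℕ∞ :=
  sInf {m : ℕ∞ | ∃ Ws : List (CVF n), (Ws.length : ℕ∞) = m ∧ (∀ W ∈ Ws, InM1B A W) ∧
    (Ws.foldl (fun g W => W.act g) f) p ≠ 0}

/-- The coefficients of the section `L = Σ_i b_i L_i` of `B`. -/
noncomputable def secCoeff {n s : ℕ} (A : Fin s → Fin n → Cn n → ℂ)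
    (b : Fin s → Cn n → ℂ) : Fin n → Cn n → ℂ :=
  fun j x => ∑ i, b i x * A i j x

/-- `min_L ν_B(λ(L,L))(p)` over smooth sections `L` of `B` with `L(p) ≠ 0`. -/
noncomputable def minNuLevi {n s : ℕ} (ρ : Cn n → ℝ) (A : Fin s → Fin n → Cn n → ℂ)
    (p : Cn n) : ℕ∞ :=
  sInf {m : ℕ∞ | ∃ b : Fin s → Cn n → ℂ, (∀ i, ContDiff ℝ (⊤ : ℕ∞) (b i)) ∧
    (fun j => secCoeff A b j p) ≠ 0 ∧
    m = nuB A (levi ρ (secCoeff A b) (secCoeff A b)) p}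

/-- The Levi-form type `c^{(s)}(B,p) = 2 + min_L ν_B(λ(L,L))(p)`. -/
noncomputable def cTypeB {n s : ℕ} (ρ : Cn n → ℝ) (A : Fin s → Fin n → Cn n → ℂ)
    (p : Cn n) : ℕ∞ :=
  2 + minNuLevi ρ A p

/-- Iterated commutators of length `μ` of elements of `𝓜₁(B)`. -/
inductive IsCommOfB {n s : ℕ} (A : Fin s → Fin n → Cn n → ℂ) : ℕ → CVF n → Prop
  | one (W : CVF n) : InM1B A W → IsCommOfB A 1 W
  | succ {μ : ℕ} (V W : CVF n) : InM1B A V → IsCommOfB A μ W →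
      IsCommOfB A (μ + 1) (V.bracket W)

/-- The commutator type `t^{(s)}(B,p)`: the smallest `m` such that `⟨∂ρ, G⟩(p) ≠ 0` for
some iterated commutator `G` of length (at most) `m` of elements of `𝓜₁(B)`; `⊤` if none. -/
noncomputable def tTypeB {n s : ℕ} (ρ : Cn n → ℝ) (A : Fin s → Fin n → Cn n → ℂ)
    (p : Cn n) : ℕ∞ :=
  sInf {m : ℕ∞ | ∃ μ : ℕ, (μ : ℕ∞) = m ∧ ∃ G : CVF n, IsCommOfB A μ G ∧ pairDRho ρ G p ≠ 0}

/-- `A` is a smooth frame of a rank-`s` CR subbundle `B ⊆ T^{1,0}M`: each `L_i` is a smooth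
CR vector field along `M` and the values `L₁(x), …, L_s(x)` are ℂ-linearly independent at
every point `x ∈ M`. -/
def IsCRFrame {n s : ℕ} (ρ : Cn n → ℝ) (M : Set (Cn n))
    (A : Fin s → Fin n → Cn n → ℂ) : Prop :=
  (∀ i, IsCRField ρ M (A i)) ∧ ∀ x ∈ M, LinearIndependent ℂ (fun i => fun j => A i j x)


open Filter Asymptotics Set Metric
open scoped ContDiff

section FlowExpansion

variable {E F : Type*} [NormedAddCommGroup E] [NormedSpace ℝ E]
  [NormedAddCommGroup F] [NormedSpace ℝ F]

/-- The derivative of `u` along the vector field `v`. -/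
noncomputable def dirDeriv (v : E → E) (u : E → F) : E → F :=
  fun x => fderiv ℝ u x (v x)

theorem ContDiff.dirDeriv {v : E → E} {u : E → F} (hv : ContDiff ℝ ∞ v)
    (hu : ContDiff ℝ ∞ u) : ContDiff ℝ ∞ (dirDeriv v u) :=
  (hu.fderiv_right (m := ∞) (by simp)).clm_apply hv

theorem ContDiff.dirDeriv_iterate {v : E → E} {u : E → F} (hv : ContDiff ℝ ∞ v)
    (hu : ContDiff ℝ ∞ u) (j : ℕ) : ContDiff ℝ ∞ ((_root_.dirDeriv v)^[j] u) := by
  induction j with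
  | zero => exact hu
  | succ j ih =>
    rw [Function.iterate_succ_apply']
    exact hv.dirDeriv ih

theorem dirDeriv_smul_iterate {v : E → E} {u : E → F} (hv : ContDiff ℝ ∞ v)
    (hu : ContDiff ℝ ∞ u) (c : ℝ) (j : ℕ) :
    (dirDeriv (c • v))^[j] u = c ^ j • (dirDeriv v)^[j] u := by
  induction j with
  | zero => simp
  | succ j ih =>
    rw [Function.iterate_succ_apply', Function.iterate_succ_apply', ih]
    funext x
    have hd : DifferentiableAt ℝ ((dirDeriv v)^[j] u) x :=
      (hv.dirDeriv_iterate hu j).differentiable (by simp) x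
    simp only [dirDeriv, Pi.smul_apply]
    rw [fderiv_const_smul hd]
    simp [smul_smul, pow_succ, mul_comm]

/-- Taylor's bound for a sequence of functions, each the derivative of the preceding one. -/
theorem norm_sub_taylor_le_of_hasDerivWithinAt {ε K : ℝ} (m : ℕ) (φ : ℕ → ℝ → F)
    (hφ : ∀ j, ∀ t ∈ Icc 0 ε, HasDerivWithinAt (φ j) (φ (j + 1) t) (Icc 0 ε) t)
    (hK : ∀ t ∈ Icc 0 ε, ‖φ m t‖ ≤ K) {t : ℝ} (ht : t ∈ Icc 0 ε) :
    ‖φ 0 t - ∑ j ∈ Finset.range m, (t ^ j / j.factorial) • φ j 0‖ ≤ K * t ^ m := by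
  induction m generalizing φ t with
  | zero => simpa using hK t ht
  | succ m ih =>
    have hsub : Icc 0 t ⊆ Icc 0 ε := Icc_subset_Icc_right ht.2
    have hder : ∀ y ∈ Icc 0 t, HasDerivWithinAt
        (fun y => φ 0 y - ∑ j ∈ Finset.range (m + 1), (y ^ j / j.factorial) • φ j 0)
        (φ 1 y - ∑ j ∈ Finset.range m, (y ^ j / j.factorial) • φ (j + 1) 0) (Icc 0 t) y := by
      intro y hy
      refine ((hφ 0 y (hsub hy)).mono hsub).sub ?_
      simp_rw [Finset.sum_range_succ']
      simp only [pow_zero, Nat.factorial_zero, Nat.cast_one, div_one, one_smul]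
      refine HasDerivWithinAt.add_const _ ?_
      refine HasDerivWithinAt.fun_sum fun j _ => ?_
      refine HasDerivWithinAt.smul_const ?_ _
      have h := ((hasDerivAt_pow (j + 1) y).div_const ((j + 1).factorial : ℝ)).hasDerivWithinAt
        (s := Icc 0 t)
      have e : y ^ j / (j.factorial : ℝ) =
          (j + 1 : ℕ) * y ^ (j + 1 - 1) / ((j + 1).factorial : ℝ) := by
        have : (j.factorial : ℝ) ≠ 0 := by positivity
        have : (j : ℝ) + 1 ≠ 0 := by positivity
        rw [Nat.factorial_succ, Nat.add_sub_cancel]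
        push_cast
        field_simp
      rw [e]
      exact h
    have hbound : ∀ y ∈ Icc 0 t,
        ‖φ 1 y - ∑ j ∈ Finset.range m, (y ^ j / j.factorial) • φ (j + 1) 0‖ ≤ K * t ^ m := by
      intro y hy
      refine (ih (fun j => φ (j + 1)) (fun j => hφ (j + 1)) hK (hsub hy)).trans ?_
      have hK0 : 0 ≤ K := (norm_nonneg _).trans (hK t ht)
      have := hy.1
      have := hy.2
      gcongr
    have key := (convex_Icc 0 t).norm_image_sub_le_of_norm_hasDerivWithin_le hder hbound
      (left_mem_Icc.2 ht.1) (right_mem_Icc.2 ht.1)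
    have hzero : φ 0 0 - ∑ j ∈ Finset.range (m + 1), ((0 : ℝ) ^ j / j.factorial) • φ j 0 = 0 := by
      rw [Finset.sum_range_succ']
      simp
    rw [hzero, sub_zero, sub_zero, Real.norm_of_nonneg ht.1] at key
    calc _ ≤ _ := key
      _ = _ := by ring

variable [ProperSpace E]

theorem exists_local_flow {v : E → E} (hv : ContDiff ℝ ∞ v) (p : E) :
    ∃ Φ : E × ℝ → E, ∃ r > 0, ∃ ε > 0, ContinuousOn Φ (closedBall p r ×ˢ Icc 0 ε) ∧
      ∀ x ∈ closedBall p r, Φ (x, 0) = x ∧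
        ∀ t ∈ Icc 0 ε, HasDerivWithinAt (fun t => Φ (x, t)) (v (Φ (x, t))) (Icc 0 ε) t := by
  obtain ⟨ε, hε, a, r, L, K, hr, h⟩ :=
    IsPicardLindelof.of_contDiffAt_one ((hv.of_le (by simp)).contDiffAt (x := p))
  obtain ⟨Φ, hΦ, hcont⟩ := (h 0).exists_forall_mem_closedBall_eq_hasDerivWithinAt_continuousOn
  have hsub : Icc 0 ε ⊆ Icc (0 - ε) (0 + ε) := Icc_subset_Icc (by linarith) (by linarith)
  refine ⟨Φ, r, hr, ε, hε, hcont.mono (prod_mono_right hsub), fun x hx => ⟨(hΦ x hx).1, ?_⟩⟩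
  exact fun t ht => ((hΦ x hx).2 t (hsub ht)).mono hsub

theorem exists_flow_taylor_bound {v : E → E} (hv : ContDiff ℝ ∞ v) {p : E} {Φ : E × ℝ → E}
    {r ε : ℝ} (hcont : ContinuousOn Φ (closedBall p r ×ˢ Icc 0 ε))
    (hΦ : ∀ x ∈ closedBall p r, Φ (x, 0) = x ∧
      ∀ t ∈ Icc 0 ε, HasDerivWithinAt (fun t => Φ (x, t)) (v (Φ (x, t))) (Icc 0 ε) t)
    {u : E → F} (hu : ContDiff ℝ ∞ u) (m : ℕ) :
    ∃ K, ∀ x ∈ closedBall p r, ∀ t ∈ Icc 0 ε,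
      ‖u (Φ (x, t)) - ∑ j ∈ Finset.range m, (t ^ j / j.factorial) • (dirDeriv v)^[j] u x‖
        ≤ K * t ^ m := by
  obtain ⟨K, hK⟩ := ((isCompact_closedBall p r).prod isCompact_Icc).exists_bound_of_continuousOn
    ((hv.dirDeriv_iterate hu m).continuous.comp_continuousOn hcont)
  refine ⟨K, fun x hx t ht => ?_⟩
  have h := norm_sub_taylor_le_of_hasDerivWithinAt m
    (fun j t => (dirDeriv v)^[j] u (Φ (x, t))) (ε := ε) (K := K) (fun j t ht => ?_)
    (fun t ht => hK (x, t) ⟨hx, ht⟩) ht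
  · simpa [(hΦ x hx).1] using h
  · rw [Function.iterate_succ_apply']
    exact (((hv.dirDeriv_iterate hu j).differentiable (by simp) _).hasFDerivAt).comp_hasDerivWithinAt
      t ((hΦ x hx).2 t ht)

/-- `γ'` arises, to infinite order at time `0`, by following the flow of `v` from `γ`. -/
def FollowsFlow (v : E → E) (γ γ' : ℝ → E) : Prop :=
  ∀ u : E → ℂ, ContDiff ℝ ∞ u → ∀ m : ℕ,
    (fun τ => u (γ' τ) - ∑ j ∈ Finset.range m, (τ ^ j / j.factorial) • (dirDeriv v)^[j] u (γ τ))
      =O[𝓝[>] 0] fun τ => τ ^ m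

theorem exists_followsFlow {v : E → E} (hv : ContDiff ℝ ∞ v) {p : E} {γ : ℝ → E}
    (hγ : Tendsto γ (𝓝[>] 0) (𝓝 p)) :
    ∃ γ', Tendsto γ' (𝓝[>] 0) (𝓝 p) ∧ FollowsFlow v γ γ' := by
  obtain ⟨Φ, r, hr, ε, hε, hcont, hΦ⟩ := exists_local_flow hv p
  have hmem : ∀ᶠ τ in 𝓝[>] (0 : ℝ), γ τ ∈ closedBall p r ∧ τ ∈ Icc 0 ε :=
    (hγ.eventually (closedBall_mem_nhds p hr)).and
      (mem_of_superset (Ioo_mem_nhdsGT hε) Ioo_subset_Icc_self)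
  refine ⟨fun τ => Φ (γ τ, τ), ?_, fun u hu m => ?_⟩
  · have hp : (p, (0 : ℝ)) ∈ closedBall p r ×ˢ Icc 0 ε :=
      ⟨mem_closedBall_self hr.le, left_mem_Icc.2 hε.le⟩
    have h := hcont (p, 0) hp
    rw [ContinuousWithinAt, (hΦ p hp.1).1] at h
    refine h.comp (tendsto_nhdsWithin_iff.2 ⟨?_, hmem⟩)
    exact hγ.prodMk_nhds (tendsto_id.mono_left nhdsWithin_le_nhds)
  · obtain ⟨K, hK⟩ := exists_flow_taylor_bound hv hcont hΦ hu m
    refine IsBigO.of_bound K ?_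
    filter_upwards [hmem] with τ hτ
    have := hK _ hτ.1 _ hτ.2
    rwa [norm_pow, Real.norm_of_nonneg hτ.2.1]

end FlowExpansion

section Flat

variable {E : Type*} [NormedAddCommGroup E] [NormedSpace ℝ E]

/-- Curves issuing from `p` that are obtained by successively following flows of fields in `V`. -/
inductive Reachable (V : Set (E → E)) (p : E) : (ℝ → E) → Prop
  | const : Reachable V p fun _ => p
  | step {γ γ' : ℝ → E} {v : E → E} : v ∈ V → Reachable V p γ →
      Tendsto γ' (𝓝[>] 0) (𝓝 p) → FollowsFlow v γ γ' → Reachable V p γ'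

theorem Reachable.tendsto {V : Set (E → E)} {p : E} {γ : ℝ → E} (h : Reachable V p γ) :
    Tendsto γ (𝓝[>] 0) (𝓝 p) := by
  cases h with
  | const => exact tendsto_const_nhds
  | step _ _ h _ => exact h

/-- `u` vanishes to order `r` along every reachable curve. -/
def IsFlat (V : Set (E → E)) (p : E) (r : ℕ) (u : E → ℂ) : Prop :=
  ∀ γ, Reachable V p γ → (fun τ => u (γ τ)) =O[𝓝[>] 0] fun τ : ℝ => τ ^ r

theorem IsFlat.add {V : Set (E → E)} {p : E} {r : ℕ} {u w : E → ℂ} (hu : IsFlat V p r u)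
    (hw : IsFlat V p r w) : IsFlat V p r (fun x => u x + w x) :=
  fun γ hγ => (hu γ hγ).add (hw γ hγ)

theorem IsFlat.const_mul {V : Set (E → E)} {p : E} {r : ℕ} {u : E → ℂ} (hu : IsFlat V p r u)
    (c : ℂ) : IsFlat V p r (fun x => c * u x) :=
  fun γ hγ => (hu γ hγ).const_mul_left c

theorem IsFlat.sum {ι : Type*} {V : Set (E → E)} {p : E} {r : ℕ} {u : ι → E → ℂ}
    {s : Finset ι} (hu : ∀ i ∈ s, IsFlat V p r (u i)) : IsFlat V p r (fun x => ∑ i ∈ s, u i x) :=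
  fun γ hγ => IsBigO.fun_sum fun i hi => hu i hi γ hγ

theorem IsFlat.apply_eq_zero {V : Set (E → E)} {p : E} {r : ℕ} {u : E → ℂ}
    (hu : IsFlat V p (r + 1) u) : u p = 0 := by
  have h0 : Tendsto (fun τ : ℝ => τ ^ (r + 1)) (𝓝[>] 0) (𝓝 0) :=
    ((continuous_pow (r + 1)).tendsto' 0 0 (by simp)).mono_left nhdsWithin_le_nhds
  exact tendsto_nhds_unique tendsto_const_nhds ((hu _ .const).trans_tendsto h0)

theorem IsFlat.of_norm_le {V : Set (E → E)} {p : E} {r : ℕ} {g f h : E → ℂ} {C K : ℝ}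
    (hf : IsFlat V p r f) (hh : IsFlat V p r h)
    (hle : ∀ᶠ x in 𝓝 p, ‖g x‖ ≤ C * ‖f x‖ + K * ‖h x‖) : IsFlat V p r g := by
  intro γ hγ
  refine IsBigO.trans (IsBigO.of_bound 1 ?_)
    (((hf γ hγ).norm_left.const_mul_left C).add ((hh γ hγ).norm_left.const_mul_left K))
  filter_upwards [hγ.tendsto.eventually hle] with τ hτ
  rw [one_mul]
  exact hτ.trans (le_abs_self _)

theorem isBigO_pow_pow_nhdsGT {m n : ℕ} (h : n ≤ m) :
    (fun τ : ℝ => τ ^ m) =O[𝓝[>] 0] fun τ => τ ^ n := by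
  refine IsBigO.of_bound 1 ?_
  filter_upwards [Ioo_mem_nhdsGT (zero_lt_one (α := ℝ))] with τ hτ
  rw [norm_pow, norm_pow, one_mul, Real.norm_of_nonneg hτ.1.le]
  exact pow_le_pow_of_le_one hτ.1.le hτ.2.le h

theorem isFlat_of_foldl_dirDeriv_eq_zero {V : Set (E → E)} (hV : ∀ v ∈ V, ContDiff ℝ ∞ v)
    {p : E} {r : ℕ} {u : E → ℂ} (hu : ContDiff ℝ ∞ u)
    (h : ∀ vs : List (E → E), (∀ v ∈ vs, v ∈ V) → vs.length < r →
      vs.foldl (fun g v => dirDeriv v g) u p = 0) : IsFlat V p r u := by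
  intro γ hγ
  induction hγ generalizing r u with
  | const =>
    cases r with
    | zero => simpa using isBigO_const_const (u p) (one_ne_zero : (1 : ℝ) ≠ 0) _
    | succ r =>
      have : u p = 0 := h [] (by simp) (by simp)
      simp [this, isBigO_zero]
  | @step γ γ' v hv _ _ hflow ih =>
    refine (IsBigO.add (hflow u hu r) (IsBigO.fun_sum (s := Finset.range r)
      (A := fun j (τ : ℝ) => (τ ^ j / (j.factorial : ℝ)) • (dirDeriv v)^[j] u (γ τ))
        fun j hj => ?_)).congr_left fun τ => sub_add_cancel _ _
    have hj' : j < r := Finset.mem_range.1 hj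
    have h1 : (fun τ => (dirDeriv v)^[j] u (γ τ)) =O[𝓝[>] 0] fun τ => τ ^ (r - j) := by
      refine ih ((hV v hv).dirDeriv_iterate hu j) fun vs hvs hlen => ?_
      have := h (List.replicate j v ++ vs) ?_ ?_
      · rw [List.foldl_append] at this
        convert this using 2
        clear * -
        induction j generalizing u with
        | zero => rfl
        | succ j ih => rw [List.replicate_succ, List.foldl_cons, Function.iterate_succ_apply, ih]
      · intro w hw
        rcases List.mem_append.1 hw with hw | hw
        · rwa [List.eq_of_mem_replicate hw]
        · exact hvs w hw
      · rw [List.length_append, List.length_replicate]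
        omega
    have h2 : (fun τ : ℝ => τ ^ j / j.factorial) =O[𝓝[>] 0] fun τ => τ ^ j := by
      simpa [div_eq_inv_mul] using (isBigO_refl (fun τ : ℝ => τ ^ j) (𝓝[>] 0)).const_mul_left
        ((j.factorial : ℝ)⁻¹)
    refine (h2.smul h1).congr_right fun τ => ?_
    rw [smul_eq_mul, ← pow_add, Nat.add_sub_cancel' hj'.le]

theorem exists_sum_mul_pow_eq_ite (m : ℕ) : ∃ w : Fin m → ℝ, ∀ j < m,
    ∑ c : Fin m, w c * ((c : ℕ) : ℝ) ^ j = if j = 1 then 1 else 0 := by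
  let A := Matrix.vandermonde fun c : Fin m => ((c : ℕ) : ℝ)
  have hA : IsUnit A.det := by
    rw [isUnit_iff_ne_zero, Matrix.det_vandermonde_ne_zero_iff]
    intro a b hab
    simpa [Fin.val_inj] using hab
  refine ⟨Matrix.vecMul (fun j : Fin m => if (j : ℕ) = 1 then (1 : ℝ) else 0) A⁻¹, fun j hj => ?_⟩
  have h := congrFun (Matrix.vecMul_vecMul
    (fun j : Fin m => if (j : ℕ) = 1 then (1 : ℝ) else 0) A⁻¹ A) ⟨j, hj⟩
  rw [Matrix.nonsing_inv_mul _ hA, Matrix.vecMul_one] at h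
  exact h

theorem IsFlat.dirDeriv [ProperSpace E] {V : Set (E → E)} (hV : ∀ v ∈ V, ContDiff ℝ ∞ v)
    (hsmul : ∀ v ∈ V, ∀ c : ℝ, c • v ∈ V) {p : E} {r : ℕ} {u : E → ℂ} (hu : ContDiff ℝ ∞ u)
    (hflat : IsFlat V p (r + 1) u) {v : E → E} (hv : v ∈ V) :
    IsFlat V p r (dirDeriv v u) := by
  intro γ hγ
  obtain ⟨w, hw⟩ := exists_sum_mul_pow_eq_ite (r + 2)
  have hexp : ∀ c : ℝ, (fun τ : ℝ => ∑ j ∈ Finset.range (r + 2),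
      (τ ^ j / j.factorial) • (_root_.dirDeriv (c • v))^[j] u (γ τ)) =O[𝓝[>] 0]
        fun τ => τ ^ (r + 1) := by
    intro c
    obtain ⟨γ', hγ', hflow⟩ := exists_followsFlow (hV _ (hsmul v hv c)) hγ.tendsto
    have h1 := (hflow u hu (r + 2)).trans (isBigO_pow_pow_nhdsGT (Nat.le_succ (r + 1)))
    exact ((hflat γ' (.step (hsmul v hv c) hγ hγ' hflow)).sub h1).congr_left
      fun τ => sub_sub_cancel _ _
  have hsum : (fun τ => τ • _root_.dirDeriv v u (γ τ)) =O[𝓝[>] 0] fun τ : ℝ => τ ^ (r + 1) := by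
    refine (IsBigO.fun_sum (s := Finset.univ) fun (c : Fin (r + 2)) _ =>
      (hexp ((c : ℕ) : ℝ)).const_smul_left (w c)).congr_left fun τ => ?_
    simp only [dirDeriv_smul_iterate (hV v hv) hu, Pi.smul_apply, Finset.smul_sum]
    rw [Finset.sum_comm]
    have : ∀ j ∈ Finset.range (r + 2), ∑ c : Fin (r + 2), w c • (τ ^ j / j.factorial) •
        ((c : ℕ) : ℝ) ^ j • (_root_.dirDeriv v)^[j] u (γ τ) =
        if j = 1 then τ • _root_.dirDeriv v u (γ τ) else 0 := by
      intro j hj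
      simp_rw [smul_smul]
      rw [← Finset.sum_smul]
      have e : ∑ c : Fin (r + 2), w c * (τ ^ j / j.factorial * ((c : ℕ) : ℝ) ^ j) =
          (τ ^ j / j.factorial) * ∑ c : Fin (r + 2), w c * ((c : ℕ) : ℝ) ^ j := by
        rw [Finset.mul_sum]
        exact Finset.sum_congr rfl fun c _ => by ring
      rw [e, hw j (Finset.mem_range.1 hj)]
      split_ifs with h
      · subst h
        simp
      · simp
    rw [Finset.sum_congr rfl this]
    simp
  refine ((isBigO_refl (fun τ : ℝ => τ⁻¹) (𝓝[>] 0)).smul hsum).congr' ?_ ?_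
  · filter_upwards [self_mem_nhdsWithin] with τ hτ
    rw [smul_smul, inv_mul_cancel₀ (ne_of_gt hτ), one_smul]
  · filter_upwards [self_mem_nhdsWithin] with τ hτ
    rw [smul_eq_mul, pow_succ', inv_mul_cancel_left₀ (ne_of_gt hτ)]

end Flat

section Hypersurface

variable {E : Type*} [NormedAddCommGroup E] [NormedSpace ℝ E]

theorem range_eq_top_of_ne_zero {L : E →L[ℝ] ℝ} (hL : L ≠ 0) : L.range = ⊤ :=
  LinearMap.range_eq_top.2 (LinearMap.surjective (f := (L : E →ₗ[ℝ] ℝ)) fun h =>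
    hL (ContinuousLinearMap.coe_injective h))

theorem eventually_exists_zero_dist_le [CompleteSpace E] {ρ : E → ℝ} (hρ : ContDiff ℝ ∞ ρ)
    {p : E} (hp : ρ p = 0) (hreg : fderiv ℝ ρ p ≠ 0) :
    ∃ κ : ℝ, ∀ᶠ x in 𝓝 p, ∃ y, ρ y = 0 ∧ dist y x ≤ κ * |ρ x| := by
  have hstrict : HasStrictFDerivAt ρ (fderiv ℝ ρ p) p :=
    hρ.contDiffAt.hasStrictFDerivAt (by simp)
  have hsurj := range_eq_top_of_ne_zero hreg
  let R := (fderiv ℝ ρ p).nonlinearRightInverseOfSurjective hsurj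
  have hR : 0 < R.nnnorm :=
    (fderiv ℝ ρ p).nonlinearRightInverseOfSurjective_nnnorm_pos hsurj
  obtain ⟨s, hs, happ⟩ := hstrict.approximates_deriv_on_nhds (c := R.nnnorm⁻¹ / 2)
    (Or.inr (by positivity))
  obtain ⟨δ, hδ, hδs⟩ := Metric.mem_nhds_iff.1 hs
  have hR' : (0 : ℝ) < R.nnnorm := hR
  refine ⟨2 * R.nnnorm, ?_⟩
  have h1 : ∀ᶠ x in 𝓝 p, dist x p < δ / 2 := Metric.ball_mem_nhds p (half_pos hδ)
  have h2 : ∀ᶠ x in 𝓝 p, 2 * R.nnnorm * |ρ x| < δ / 2 := by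
    have : ContinuousAt (fun x => 2 * (R.nnnorm : ℝ) * |ρ x|) p :=
      (continuous_const.mul hρ.continuous.abs).continuousAt
    exact this.eventually_lt continuousAt_const (by simpa [hp] using hδ)
  filter_upwards [h1, h2] with x hx1 hx2
  have hball : closedBall x (2 * R.nnnorm * |ρ x|) ⊆ s := fun y hy => hδs <| by
    have := dist_triangle y x p
    have := mem_closedBall.1 hy
    rw [mem_ball]
    linarith
  have hsub := happ.surjOn_closedBall_of_nonlinearRightInverse R (by positivity) hball
  obtain ⟨y, hy, hy0⟩ := hsub (a := 0) <| by
    rw [mem_closedBall, dist_zero_left, Real.norm_eq_abs]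
    push_cast
    field_simp
    norm_num
  exact ⟨y, hy0, hy⟩

theorem eventually_norm_le_of_norm_le_on_zeros [CompleteSpace E] {ρ : E → ℝ}
    (hρ : ContDiff ℝ ∞ ρ) {p : E} (hp : ρ p = 0) (hreg : fderiv ℝ ρ p ≠ 0) {f g : E → ℂ}
    (hf : ContDiff ℝ ∞ f) (hg : ContDiff ℝ ∞ g) {C : ℝ} (hC : 0 ≤ C)
    (hle : ∀ᶠ x in 𝓝 p, ρ x = 0 → ‖g x‖ ≤ C * ‖f x‖) :
    ∃ K : ℝ, ∀ᶠ x in 𝓝 p, ‖g x‖ ≤ C * ‖f x‖ + K * ‖(ρ x : ℂ)‖ := by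
  obtain ⟨κ, hκ⟩ := eventually_exists_zero_dist_le hρ hp hreg
  obtain ⟨Kf, sf, hsf, hLf⟩ := ((hf.of_le (by simp)).contDiffAt (x := p)).exists_lipschitzOnWith
  obtain ⟨Kg, sg, hsg, hLg⟩ := ((hg.of_le (by simp)).contDiffAt (x := p)).exists_lipschitzOnWith
  obtain ⟨δ, hδ, hδs⟩ := Metric.mem_nhds_iff.1 (inter_mem (inter_mem hsf hsg) hle)
  refine ⟨(Kg + C * Kf) * κ, ?_⟩
  have h1 : ∀ᶠ x in 𝓝 p, dist x p < δ / 2 := Metric.ball_mem_nhds p (half_pos hδ)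
  have h2 : ∀ᶠ x in 𝓝 p, κ * |ρ x| < δ / 2 := by
    have : ContinuousAt (fun x => κ * |ρ x|) p :=
      (continuous_const.mul hρ.continuous.abs).continuousAt
    exact this.eventually_lt continuousAt_const (by simpa [hp] using hδ)
  filter_upwards [hκ, h1, h2] with x ⟨y, hy0, hyx⟩ hx1 hx2
  have hxs := hδs (mem_ball.2 (hx1.trans (half_lt_self hδ)))
  have hys := hδs (a := y) (by
    have := dist_triangle y x p
    rw [mem_ball]
    linarith)
  have hgy : ‖g y‖ ≤ C * ‖f y‖ := hys.2 hy0
  have hgx : ‖g x‖ ≤ ‖g y‖ + Kg * dist y x := by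
    have := hLg.dist_le_mul x hxs.1.2 y hys.1.2
    rw [dist_comm x y, dist_eq_norm] at this
    linarith [norm_le_norm_add_norm_sub' (g x) (g y)]
  have hfy : ‖f y‖ ≤ ‖f x‖ + Kf * dist y x := by
    have := hLf.dist_le_mul y hys.1.1 x hxs.1.1
    rw [dist_eq_norm (f y)] at this
    linarith [norm_le_norm_add_norm_sub' (f y) (f x)]
  rw [Complex.norm_real, Real.norm_eq_abs]
  have hCf := mul_le_mul_of_nonneg_left hfy hC
  have hK : 0 ≤ (Kg : ℝ) + C * Kf := by positivity
  have := mul_le_mul_of_nonneg_left hyx hK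
  linarith

theorem fderiv_eq_zero_of_eq_zero_on_zeros [CompleteSpace E] {ρ φ : E → ℝ}
    (hρ : ContDiff ℝ ∞ ρ) (hφ : ContDiff ℝ ∞ φ) (h0 : ∀ x, ρ x = 0 → φ x = 0) {x : E}
    (hx : ρ x = 0) (hreg : fderiv ℝ ρ x ≠ 0) {v : E} (hv : fderiv ℝ ρ x v = 0) :
    fderiv ℝ φ x v = 0 := by
  have hextr : IsLocalExtrOn φ {y | ρ y = ρ x} x := by
    left
    filter_upwards [self_mem_nhdsWithin] with y hy
    rw [h0 x hx, h0 y (Eq.trans hy hx)]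
  obtain ⟨a, b, hab, h⟩ := hextr.exists_multipliers_of_hasStrictFDerivAt_1d
    (hρ.contDiffAt.hasStrictFDerivAt (by simp)) (hφ.contDiffAt.hasStrictFDerivAt (by simp))
  have hb : b ≠ 0 := by
    rintro rfl
    have ha : a ≠ 0 := by simpa using hab
    exact hreg (by simpa [ha] using h)
  have := congrArg (fun L : E →L[ℝ] ℝ => L v) h
  simpa [hv, hb] using this

theorem dirDeriv_eq_zero_of_eq_zero_on_zeros [CompleteSpace E] {ρ : E → ℝ} {u : E → ℂ}
    (hρ : ContDiff ℝ ∞ ρ) (hu : ContDiff ℝ ∞ u) (h0 : ∀ x, ρ x = 0 → u x = 0) {v : E → E} {x : E}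
    (hx : ρ x = 0) (hreg : fderiv ℝ ρ x ≠ 0) (hv : fderiv ℝ ρ x (v x) = 0) :
    dirDeriv v u x = 0 := by
  have hd : HasFDerivAt u (fderiv ℝ u x) x := (hu.differentiable (by simp) x).hasFDerivAt
  have hre := (Complex.reCLM.hasFDerivAt (x := u x)).comp x hd
  have him := (Complex.imCLM.hasFDerivAt (x := u x)).comp x hd
  have h1 := fderiv_eq_zero_of_eq_zero_on_zeros hρ (Complex.reCLM.contDiff.comp hu)
    (fun y hy => by simp [h0 y hy]) hx hreg hv
  have h2 := fderiv_eq_zero_of_eq_zero_on_zeros hρ (Complex.imCLM.contDiff.comp hu)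
    (fun y hy => by simp [h0 y hy]) hx hreg hv
  rw [hre.fderiv] at h1
  rw [him.fderiv] at h2
  exact Complex.ext h1 h2

theorem isFlat_of_eq_zero_on_zeros [CompleteSpace E] {V : Set (E → E)}
    (hV : ∀ v ∈ V, ContDiff ℝ ∞ v) {ρ : E → ℝ} {u : E → ℂ} (hρ : ContDiff ℝ ∞ ρ)
    (hreg : ∀ x, ρ x = 0 → fderiv ℝ ρ x ≠ 0)
    (htan : ∀ v ∈ V, ∀ x, ρ x = 0 → fderiv ℝ ρ x (v x) = 0) (hu : ContDiff ℝ ∞ u)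
    (h0 : ∀ x, ρ x = 0 → u x = 0) {p : E} (hp : ρ p = 0) (r : ℕ) : IsFlat V p r u := by
  refine isFlat_of_foldl_dirDeriv_eq_zero hV hu fun vs hvs hlen => ?_
  clear hlen
  induction vs generalizing u with
  | nil => exact h0 p hp
  | cons v vs ih =>
    have hv : v ∈ V := hvs v (by simp)
    exact ih ((hV v hv).dirDeriv hu)
      (fun x hx => dirDeriv_eq_zero_of_eq_zero_on_zeros hρ hu h0 hx (hreg x hx) (htan v hv x hx))
      (fun w hw => hvs w (List.mem_cons_of_mem _ hw))

end Hypersurface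

section Wirtinger

variable {n : ℕ}

theorem fderiv_apply_eq_sum_wirtinger (u : Cn n → ℂ) (x v : Cn n) :
    fderiv ℝ u x v = (∑ j, v j * wz j u x) + ∑ j, starRingEnd ℂ (v j) * wzb j u x := by
  have hv : v =
      ∑ j, ((v j).re • (Pi.single j 1 : Cn n) + (v j).im • (Pi.single j Complex.I : Cn n)) := by
    funext k
    simp [Finset.sum_apply, Pi.single_apply, Finset.sum_add_distrib]
  conv_lhs => rw [hv]
  rw [map_sum, ← Finset.sum_add_distrib]
  refine Finset.sum_congr rfl fun j _ => ?_
  rw [map_add, map_smul, map_smul]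
  simp only [wz, wzb, Complex.real_smul]
  generalize fderiv ℝ u x (Pi.single j 1) = a
  generalize fderiv ℝ u x (Pi.single j Complex.I) = b
  have h1 : v j = (v j).re + (v j).im * Complex.I := (Complex.re_add_im _).symm
  have h2 : starRingEnd ℂ (v j) = (v j).re - (v j).im * Complex.I := by
    apply Complex.ext <;> simp
  rw [h2]
  nth_rw 3 [h1]
  linear_combination ((v j).im * b) * Complex.I_sq

/-- The first of the two real vector fields `X₁`, `X₂` with `W = X₁ + i X₂`. -/
noncomputable def CVF.rePart (W : CVF n) : Cn n → Cn n :=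
  fun x j => (W.hol j x + starRingEnd ℂ (W.anti j x)) / 2

/-- The second of the two real vector fields `X₁`, `X₂` with `W = X₁ + i X₂`. -/
noncomputable def CVF.imPart (W : CVF n) : Cn n → Cn n :=
  fun x j => (W.hol j x - starRingEnd ℂ (W.anti j x)) / (2 * Complex.I)

theorem CVF.act_eq_dirDeriv (W : CVF n) (u : Cn n → ℂ) :
    W.act u = fun x => dirDeriv W.rePart u x + Complex.I * dirDeriv W.imPart u x := by
  funext x
  simp only [dirDeriv, fderiv_apply_eq_sum_wirtinger, CVF.act, Finset.mul_sum, mul_add,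
    ← Finset.sum_add_distrib]
  refine Finset.sum_congr rfl fun j _ => ?_
  simp only [CVF.rePart, CVF.imPart, map_div₀, map_add, map_sub, map_mul, Complex.conj_conj,
    Complex.conj_I, map_ofNat]
  have := Complex.I_ne_zero
  field_simp
  ring

/-- The real vector fields in the module generated by the frame `A` and its conjugates, given by
their `(1,0)` components. -/
def realSections {s : ℕ} (A : Fin s → Fin n → Cn n → ℂ) : Set (Cn n → Cn n) :=
  {v | ∃ c : Fin s → Cn n → ℂ, (∀ i, ContDiff ℝ ∞ (c i)) ∧
    v = fun x j => secCoeff A c j x}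

variable {s : ℕ} {A : Fin s → Fin n → Cn n → ℂ}

theorem contDiff_secCoeff (hA : ∀ i j, ContDiff ℝ ∞ (A i j)) {c : Fin s → Cn n → ℂ}
    (hc : ∀ i, ContDiff ℝ ∞ (c i)) (j : Fin n) : ContDiff ℝ ∞ (secCoeff A c j) :=
  ContDiff.sum fun i _ => (hc i).mul (hA i j)

theorem contDiff_of_mem_realSections (hA : ∀ i j, ContDiff ℝ ∞ (A i j)) :
    ∀ v ∈ realSections A, ContDiff ℝ ∞ v := by
  rintro _ ⟨c, hc, rfl⟩
  exact contDiff_pi.2 fun j => contDiff_secCoeff hA hc j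

theorem smul_mem_realSections : ∀ v ∈ realSections A, ∀ t : ℝ, t • v ∈ realSections A := by
  rintro _ ⟨c, hc, rfl⟩ t
  refine ⟨fun i x => t * c i x, fun i => contDiff_const.mul (hc i), ?_⟩
  funext x j
  simp [secCoeff, Finset.mul_sum, mul_assoc]

theorem contDiff_conj {f : Cn n → ℂ} (hf : ContDiff ℝ ∞ f) :
    ContDiff ℝ ∞ fun x => starRingEnd ℂ (f x) :=
  Complex.conjCLE.contDiff.comp hf

theorem InM1B.rePart_mem {W : CVF n} (hW : InM1B A W) : W.rePart ∈ realSections A := by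
  obtain ⟨c, d, hc, hd, h1, h2⟩ := hW
  refine ⟨fun i x => (c i x + starRingEnd ℂ (d i x)) / 2,
    fun i => ((hc i).add (contDiff_conj (hd i))).div_const 2, ?_⟩
  funext x j
  simp only [CVF.rePart, h1, h2, secCoeff, map_sum, map_mul, Complex.conj_conj,
    ← Finset.sum_add_distrib, Finset.sum_div]
  exact Finset.sum_congr rfl fun i _ => by ring

theorem InM1B.imPart_mem {W : CVF n} (hW : InM1B A W) : W.imPart ∈ realSections A := by
  obtain ⟨c, d, hc, hd, h1, h2⟩ := hW
  refine ⟨fun i x => (c i x - starRingEnd ℂ (d i x)) / (2 * Complex.I),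
    fun i => ((hc i).sub (contDiff_conj (hd i))).div_const _, ?_⟩
  funext x j
  simp only [CVF.imPart, h1, h2, secCoeff, map_sum, map_mul, Complex.conj_conj,
    ← Finset.sum_sub_distrib, Finset.sum_div]
  exact Finset.sum_congr rfl fun i _ => by ring

theorem InM1B.contDiff_act (hA : ∀ i j, ContDiff ℝ ∞ (A i j)) {W : CVF n} (hW : InM1B A W)
    {u : Cn n → ℂ} (hu : ContDiff ℝ ∞ u) : ContDiff ℝ ∞ (W.act u) := by
  rw [CVF.act_eq_dirDeriv]
  exact ((contDiff_of_mem_realSections hA _ hW.rePart_mem).dirDeriv hu).add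
    (contDiff_const.mul ((contDiff_of_mem_realSections hA _ hW.imPart_mem).dirDeriv hu))

theorem IsFlat.act (hA : ∀ i j, ContDiff ℝ ∞ (A i j)) {W : CVF n} (hW : InM1B A W)
    {u : Cn n → ℂ} (hu : ContDiff ℝ ∞ u) {p : Cn n} {r : ℕ}
    (hflat : IsFlat (realSections A) p (r + 1) u) :
    IsFlat (realSections A) p r (W.act u) := by
  have hV := contDiff_of_mem_realSections hA
  rw [CVF.act_eq_dirDeriv]
  exact (hflat.dirDeriv hV smul_mem_realSections hu hW.rePart_mem).add
    ((hflat.dirDeriv hV smul_mem_realSections hu hW.imPart_mem).const_mul _)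

theorem IsFlat.foldl_act_eq_zero (hA : ∀ i j, ContDiff ℝ ∞ (A i j)) {p : Cn n} (Ws : List (CVF n))
    (hWs : ∀ W ∈ Ws, InM1B A W) {u : Cn n → ℂ} (hu : ContDiff ℝ ∞ u) {r : ℕ}
    (hflat : IsFlat (realSections A) p r u) (hlen : Ws.length < r) :
    Ws.foldl (fun g W => W.act g) u p = 0 := by
  obtain ⟨r, rfl⟩ : ∃ k, r = k + 1 := ⟨r - 1, by omega⟩
  induction Ws generalizing u r with
  | nil => exact hflat.apply_eq_zero
  | cons W Ws ih =>
    have hW := hWs W (by simp)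
    rw [List.length_cons] at hlen
    obtain ⟨r, rfl⟩ : ∃ k, r = k + 1 := ⟨r - 1, by omega⟩
    exact ih (fun Y hY => hWs Y (List.mem_cons_of_mem _ hY)) (hW.contDiff_act hA hu) r
      (hflat.act hA hW hu) (by omega)

/-- The real vector field with `(1,0)` component `v`. -/
def CVF.ofReal (v : Cn n → Cn n) : CVF n :=
  ⟨fun j x => v x j, fun j x => starRingEnd ℂ (v x j)⟩

theorem CVF.ofReal_act (v : Cn n → Cn n) (u : Cn n → ℂ) :
    (CVF.ofReal v).act u = dirDeriv v u := by
  funext x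
  simp [dirDeriv, fderiv_apply_eq_sum_wirtinger, CVF.act, CVF.ofReal]

theorem inM1B_ofReal {v : Cn n → Cn n} (hv : v ∈ realSections A) : InM1B A (CVF.ofReal v) := by
  obtain ⟨c, hc, rfl⟩ := hv
  exact ⟨c, fun i x => starRingEnd ℂ (c i x), hc, fun i => contDiff_conj (hc i),
    fun j x => rfl, fun j x => by simp [CVF.ofReal, secCoeff]⟩

theorem natCast_le_nuB_iff (hA : ∀ i j, ContDiff ℝ ∞ (A i j)) {u : Cn n → ℂ}
    (hu : ContDiff ℝ ∞ u) {p : Cn n} {r : ℕ} :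
    (r : ℕ∞) ≤ nuB A u p ↔ IsFlat (realSections A) p r u := by
  constructor
  · intro h
    refine isFlat_of_foldl_dirDeriv_eq_zero (contDiff_of_mem_realSections hA) hu
      fun vs hvs hlen => ?_
    by_contra hne
    have hle : nuB A u p ≤ (vs.length : ℕ∞) := by
      refine sInf_le ⟨vs.map CVF.ofReal, by simp, ?_, ?_⟩
      · intro W hW
        obtain ⟨v, hv, rfl⟩ := List.mem_map.1 hW
        exact inM1B_ofReal (hvs v hv)
      · rw [List.foldl_map]
        simpa only [CVF.ofReal_act] using hne
    exact absurd (Nat.cast_le.1 (h.trans hle)) (not_le.2 hlen)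
  · intro h
    refine le_sInf ?_
    rintro _ ⟨Ws, rfl, hWs, hne⟩
    rw [Nat.cast_le]
    by_contra hlt
    exact hne (h.foldl_act_eq_zero hA Ws hWs hu (not_le.1 hlt))

end Wirtinger

section LeviForm

variable {n : ℕ}

theorem contDiff_cx {ρ : Cn n → ℝ} (hρ : ContDiff ℝ ∞ ρ) : ContDiff ℝ ∞ (cx ρ) :=
  Complex.ofRealCLM.contDiff.comp hρ

theorem contDiff_fderiv_apply {f : Cn n → ℂ} (hf : ContDiff ℝ ∞ f) (v : Cn n) :
    ContDiff ℝ ∞ fun x => fderiv ℝ f x v :=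
  (hf.fderiv_right (m := ∞) (by simp)).clm_apply contDiff_const

theorem contDiff_wz {f : Cn n → ℂ} (hf : ContDiff ℝ ∞ f) (j : Fin n) : ContDiff ℝ ∞ (wz j f) :=
  ((contDiff_fderiv_apply hf _).sub
    (contDiff_const.mul (contDiff_fderiv_apply hf _))).div_const 2

theorem contDiff_wzb {f : Cn n → ℂ} (hf : ContDiff ℝ ∞ f) (j : Fin n) : ContDiff ℝ ∞ (wzb j f) :=
  ((contDiff_fderiv_apply hf _).add
    (contDiff_const.mul (contDiff_fderiv_apply hf _))).div_const 2

theorem contDiff_levi {ρ : Cn n → ℝ} (hρ : ContDiff ℝ ∞ ρ) {ξ η : Fin n → Cn n → ℂ}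
    (hξ : ∀ j, ContDiff ℝ ∞ (ξ j)) (hη : ∀ j, ContDiff ℝ ∞ (η j)) :
    ContDiff ℝ ∞ (levi ρ ξ η) :=
  ContDiff.sum fun j _ => ContDiff.sum fun l _ =>
    ((contDiff_wz (contDiff_wzb (contDiff_cx hρ) l) j).mul (hξ j)).mul (contDiff_conj (hη l))

theorem fderiv_cx {ρ : Cn n → ℝ} (hρ : ContDiff ℝ ∞ ρ) (x v : Cn n) :
    fderiv ℝ (cx ρ) x v = (fderiv ℝ ρ x v : ℂ) := by
  have := (Complex.ofRealCLM.hasFDerivAt (x := ρ x)).comp x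
    (hρ.differentiable (by simp) x).hasFDerivAt
  exact congrArg (fun L : Cn n →L[ℝ] ℂ => L v) this.fderiv

theorem wzb_cx {ρ : Cn n → ℝ} (hρ : ContDiff ℝ ∞ ρ) (j : Fin n) (x : Cn n) :
    wzb j (cx ρ) x = starRingEnd ℂ (wz j (cx ρ) x) := by
  simp [wz, wzb, fderiv_cx hρ, map_ofNat]

theorem fderiv_apply_eq_zero_of_isCR {ρ : Cn n → ℝ} (hρ : ContDiff ℝ ∞ ρ) {x v : Cn n}
    (hv : ∑ j, v j * wz j (cx ρ) x = 0) : fderiv ℝ ρ x v = 0 := by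
  have h := fderiv_apply_eq_sum_wirtinger (cx ρ) x v
  simp only [wzb_cx hρ, ← map_mul, ← map_sum, hv, map_zero, add_zero, fderiv_cx hρ] at h
  exact_mod_cast h

theorem fderiv_fderiv_cx {ρ : Cn n → ℝ} (hρ : ContDiff ℝ ∞ ρ) (x v w : Cn n) :
    fderiv ℝ (fun y => fderiv ℝ (cx ρ) y v) x w = (fderiv ℝ (fderiv ℝ ρ) x w v : ℂ) := by
  have h1 : (fun y => fderiv ℝ (cx ρ) y v) = cx fun y => fderiv ℝ ρ y v :=
    funext fun y => fderiv_cx hρ y v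
  have h2 : ContDiff ℝ ∞ (fderiv ℝ ρ) := hρ.fderiv_right (by simp)
  rw [h1, fderiv_cx (h2.clm_apply contDiff_const)]
  have h3 := (h2.differentiable (by simp) x).hasFDerivAt.clm_apply (hasFDerivAt_const v x)
  rw [h3.fderiv]
  simp

theorem conj_leviCoeff {ρ : Cn n → ℝ} (hρ : ContDiff ℝ ∞ ρ) (j l : Fin n) (x : Cn n) :
    starRingEnd ℂ (leviCoeff ρ j l x) = leviCoeff ρ l j x := by
  have key : ∀ (j l : Fin n), leviCoeff ρ j l x =
      ((fderiv ℝ (fderiv ℝ ρ) x (Pi.single j 1) (Pi.single l 1) : ℂ) +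
        fderiv ℝ (fderiv ℝ ρ) x (Pi.single j Complex.I) (Pi.single l Complex.I) +
        Complex.I * (fderiv ℝ (fderiv ℝ ρ) x (Pi.single j 1) (Pi.single l Complex.I) -
          fderiv ℝ (fderiv ℝ ρ) x (Pi.single j Complex.I) (Pi.single l 1))) / 4 := by
    intro j l
    have hd : ∀ v : Cn n, DifferentiableAt ℝ (fun y => fderiv ℝ (cx ρ) y v) x := fun v =>
      (contDiff_fderiv_apply (contDiff_cx hρ) v).differentiable (by simp) x
    have h : ∀ w, fderiv ℝ (wzb l (cx ρ)) x w =
        ((fderiv ℝ (fderiv ℝ ρ) x w (Pi.single l 1) : ℂ) +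
          Complex.I * fderiv ℝ (fderiv ℝ ρ) x w (Pi.single l Complex.I)) / 2 := by
      intro w
      rw [← fderiv_fderiv_cx hρ, ← fderiv_fderiv_cx hρ]
      have := (((hd (Pi.single l 1)).hasFDerivAt.add
        ((hd (Pi.single l Complex.I)).hasFDerivAt.const_mul Complex.I)).mul_const (2 : ℂ)⁻¹)
      have h2 : wzb l (cx ρ) = fun y => (fderiv ℝ (cx ρ) y (Pi.single l 1) +
        Complex.I * fderiv ℝ (cx ρ) y (Pi.single l Complex.I)) * (2 : ℂ)⁻¹ := by
        funext y
        rw [wzb, div_eq_mul_inv]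
      rw [h2]
      refine (congrArg (fun L : Cn n →L[ℝ] ℂ => L w) this.fderiv).trans ?_
      simp
      ring
    rw [leviCoeff, wz, h, h]
    linear_combination (-(fderiv ℝ (fderiv ℝ ρ) x (Pi.single j Complex.I)
      (Pi.single l Complex.I) : ℂ) / 4) * Complex.I_sq
  have hsymm : IsSymmSndFDerivAt ℝ ρ x := (hρ.contDiffAt (x := x)).isSymmSndFDerivAt (by
    simpa using WithTop.coe_le_coe.2 (le_top (a := (2 : ℕ∞))))
  rw [key, key, hsymm (Pi.single l 1) (Pi.single j 1),
    hsymm (Pi.single l Complex.I) (Pi.single j Complex.I),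
    hsymm (Pi.single l 1) (Pi.single j Complex.I), hsymm (Pi.single l Complex.I) (Pi.single j 1)]
  simp only [map_div₀, map_add, map_mul, map_sub, Complex.conj_ofReal, Complex.conj_I, map_ofNat]
  ring

/-- The value at `x` of the Levi form on the vectors with components `ξ` and `η`. -/
noncomputable def leviAt (ρ : Cn n → ℝ) (x : Cn n) (ξ η : Fin n → ℂ) : ℂ :=
  ∑ j, ∑ l, leviCoeff ρ j l x * ξ j * starRingEnd ℂ (η l)

theorem leviAt_add_left (ρ : Cn n → ℝ) (x : Cn n) (ξ ξ' η : Fin n → ℂ) :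
    leviAt ρ x (ξ + ξ') η = leviAt ρ x ξ η + leviAt ρ x ξ' η := by
  simp only [leviAt, ← Finset.sum_add_distrib, Pi.add_apply]
  exact Finset.sum_congr rfl fun j _ => Finset.sum_congr rfl fun l _ => by ring

theorem leviAt_add_right (ρ : Cn n → ℝ) (x : Cn n) (ξ η η' : Fin n → ℂ) :
    leviAt ρ x ξ (η + η') = leviAt ρ x ξ η + leviAt ρ x ξ η' := by
  simp only [leviAt, ← Finset.sum_add_distrib, Pi.add_apply, map_add]
  exact Finset.sum_congr rfl fun j _ => Finset.sum_congr rfl fun l _ => by ring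

theorem leviAt_smul_smul (ρ : Cn n → ℝ) (x : Cn n) (c d : ℂ) (ξ η : Fin n → ℂ) :
    leviAt ρ x (c • ξ) (d • η) = c * starRingEnd ℂ d * leviAt ρ x ξ η := by
  simp only [leviAt, Finset.mul_sum, Pi.smul_apply, smul_eq_mul, map_mul]
  exact Finset.sum_congr rfl fun j _ => Finset.sum_congr rfl fun l _ => by ring

theorem leviAt_self_im {ρ : Cn n → ℝ} (hρ : ContDiff ℝ ∞ ρ) (x : Cn n) (ξ : Fin n → ℂ) :
    (leviAt ρ x ξ ξ).im = 0 := by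
  rw [← Complex.conj_eq_iff_im, leviAt]
  simp only [map_sum, map_mul, conj_leviCoeff hρ, Complex.conj_conj]
  rw [Finset.sum_comm]
  exact Finset.sum_congr rfl fun j _ => Finset.sum_congr rfl fun l _ => by ring

theorem leviAt_parallelogram (ρ : Cn n → ℝ) (x : Cn n) (ξ η : Fin n → ℂ) :
    leviAt ρ x (ξ + η) (ξ + η) + leviAt ρ x (ξ + (-1 : ℂ) • η) (ξ + (-1 : ℂ) • η) =
      2 * leviAt ρ x ξ ξ + 2 * leviAt ρ x η η := by
  have h1 := leviAt_smul_smul ρ x 1 (-1) ξ η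
  have h2 := leviAt_smul_smul ρ x (-1) 1 η ξ
  have h3 := leviAt_smul_smul ρ x (-1) (-1) η η
  simp only [one_smul, map_one, map_neg] at h1 h2 h3
  simp only [leviAt_add_left, leviAt_add_right, h1, h2, h3]
  ring

/-- The complex tangent space of the level set of `ρ` through `x`. -/
noncomputable def crSpace (ρ : Cn n → ℝ) (x : Cn n) : Submodule ℂ (Fin n → ℂ) where
  carrier := {ξ | ∑ j, ξ j * wz j (cx ρ) x = 0}
  add_mem' {ξ η} hξ hη := by
    simp_all [add_mul, Finset.sum_add_distrib]
  zero_mem' := by simp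
  smul_mem' c ξ hξ := by
    have : ∑ j, ξ j * wz j (cx ρ) x = 0 := hξ
    simp [mul_assoc, ← Finset.mul_sum, this]

theorem leviAt_sum_re_le {ρ : Cn n → ℝ} {x : Cn n}
    (hpos : ∀ ξ ∈ crSpace ρ x, 0 ≤ (leviAt ρ x ξ ξ).re) {ι : Type*} (s : Finset ι)
    {ξ : ι → Fin n → ℂ} (hξ : ∀ i ∈ s, ξ i ∈ crSpace ρ x) :
    (leviAt ρ x (∑ i ∈ s, ξ i) (∑ i ∈ s, ξ i)).re ≤
      2 ^ s.card * ∑ i ∈ s, (leviAt ρ x (ξ i) (ξ i)).re := by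
  classical
  induction s using Finset.induction_on with
  | empty => simp [leviAt]
  | insert a s ha ih =>
    have hs : ∀ i ∈ s, ξ i ∈ crSpace ρ x := fun i hi => hξ i (Finset.mem_insert_of_mem hi)
    have haξ := hξ a (Finset.mem_insert_self a s)
    rw [Finset.sum_insert ha, Finset.sum_insert ha, Finset.card_insert_of_notMem ha, pow_succ]
    have hpar := congrArg Complex.re (leviAt_parallelogram ρ x (ξ a) (∑ i ∈ s, ξ i))
    have hdiff := hpos _ ((crSpace ρ x).add_mem haξ
      ((crSpace ρ x).smul_mem (-1) ((crSpace ρ x).sum_mem hs)))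
    have h2 : (2 : ℂ) = ((2 : ℝ) : ℂ) := by simp
    rw [h2, Complex.add_re, Complex.add_re, Complex.re_ofReal_mul, Complex.re_ofReal_mul] at hpar
    have hge : (1 : ℝ) ≤ 2 ^ s.card := one_le_pow₀ one_le_two
    have := mul_le_mul_of_nonneg_right hge (hpos _ haξ)
    linarith [ih hs]

theorem norm_leviAt_self {ρ : Cn n → ℝ} (hρ : ContDiff ℝ ∞ ρ) {x : Cn n} {ξ : Fin n → ℂ}
    (hpos : 0 ≤ (leviAt ρ x ξ ξ).re) : ‖leviAt ρ x ξ ξ‖ = (leviAt ρ x ξ ξ).re := by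
  have : leviAt ρ x ξ ξ = ((leviAt ρ x ξ ξ).re : ℂ) :=
    Complex.ext (by simp) (by simp [leviAt_self_im hρ])
  rw [this, Complex.norm_real, Complex.ofReal_re, Real.norm_of_nonneg hpos]

theorem norm_leviAt_sum_le {ρ : Cn n → ℝ} (hρ : ContDiff ℝ ∞ ρ) {x : Cn n}
    (hpos : ∀ ξ ∈ crSpace ρ x, 0 ≤ (leviAt ρ x ξ ξ).re) {s : ℕ} {ξ : Fin s → Fin n → ℂ}
    (hξ : ∀ i, ξ i ∈ crSpace ρ x) {b : Fin s → ℂ} {C : ℝ} (hb : ∑ i, ‖b i‖ ^ 2 ≤ C) :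
    ‖leviAt ρ x (∑ i, b i • ξ i) (∑ i, b i • ξ i)‖ ≤
      2 ^ s * C * ‖∑ i, leviAt ρ x (ξ i) (ξ i)‖ := by
  have hbξ : ∀ i ∈ Finset.univ, b i • ξ i ∈ crSpace ρ x := fun i _ =>
    (crSpace ρ x).smul_mem _ (hξ i)
  have hC : 0 ≤ C := (Finset.sum_nonneg fun i _ => sq_nonneg ‖b i‖).trans hb
  rw [norm_leviAt_self hρ (hpos _ ((crSpace ρ x).sum_mem hbξ))]
  refine (leviAt_sum_re_le hpos _ hbξ).trans ?_
  rw [Finset.card_univ, Fintype.card_fin, mul_assoc]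
  refine mul_le_mul_of_nonneg_left ?_ (by positivity)
  refine le_trans ?_ (mul_le_mul_of_nonneg_left (Complex.re_le_norm _) hC)
  rw [Complex.re_sum, Finset.mul_sum]
  refine Finset.sum_le_sum fun i hi => ?_
  rw [leviAt_smul_smul, Complex.mul_conj', ← Complex.ofReal_pow, Complex.re_ofReal_mul]
  refine mul_le_mul_of_nonneg_right (le_trans ?_ hb) (hpos _ (hξ i))
  exact Finset.single_le_sum (f := fun i => ‖b i‖ ^ 2) (fun i _ => sq_nonneg _) hi

theorem levi_eq_leviAt (ρ : Cn n → ℝ) (ξ η : Fin n → Cn n → ℂ) (x : Cn n) :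
    levi ρ ξ η x = leviAt ρ x (fun j => ξ j x) fun j => η j x := rfl

theorem isFlat_levi_secCoeff {s : ℕ} {ρ : Cn n → ℝ} (hρ : ContDiff ℝ ∞ ρ)
    (hreg : ∀ x, ρ x = 0 → fderiv ℝ ρ x ≠ 0) (hpsc : Pseudoconvex ρ {x | ρ x = 0})
    {A : Fin s → Fin n → Cn n → ℂ} (hA : ∀ i, IsCRField ρ {x | ρ x = 0} (A i)) {p : Cn n}
    (hp : ρ p = 0) {b : Fin s → Cn n → ℂ} (hb : ∀ i, ContDiff ℝ ∞ (b i)) {r : ℕ}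
    (hflat : IsFlat (realSections A) p r fun x => ∑ i, levi ρ (A i) (A i) x) :
    IsFlat (realSections A) p r (levi ρ (secCoeff A b) (secCoeff A b)) := by
  have hAs : ∀ i j, ContDiff ℝ ∞ (A i j) := fun i => (hA i).1
  have hsec : ∀ c : Fin s → Cn n → ℂ, ∀ x, (fun j => secCoeff A c j x) =
      ∑ i, c i x • fun j => A i j x := by
    intro c x
    funext j
    simp [secCoeff, Finset.sum_apply]
  have hAcr : ∀ x, ρ x = 0 → ∀ i, (fun j => A i j x) ∈ crSpace ρ x := fun x hx i => (hA i).2 x hx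
  have hρflat : IsFlat (realSections A) p r (cx ρ) := by
    refine isFlat_of_eq_zero_on_zeros (contDiff_of_mem_realSections hAs) hρ hreg ?_
      (contDiff_cx hρ) (fun x hx => by simp [cx, hx]) hp r
    rintro _ ⟨c, -, rfl⟩ x hx
    refine fderiv_apply_eq_zero_of_isCR hρ ?_
    change (fun j => secCoeff A c j x) ∈ crSpace ρ x
    rw [hsec]
    exact (crSpace ρ x).sum_mem fun i _ => (crSpace ρ x).smul_mem _ (hAcr x hx i)
  have hbound : ∀ᶠ x in 𝓝 p, ∑ i, ‖b i x‖ ^ 2 < ∑ i, ‖b i p‖ ^ 2 + 1 := by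
    have hcont : Continuous fun x => ∑ i, ‖b i x‖ ^ 2 :=
      continuous_finsetSum _ fun i _ => (hb i).continuous.norm.pow 2
    exact hcont.continuousAt.eventually_lt continuousAt_const (lt_add_one _)
  obtain ⟨K, hK⟩ := eventually_norm_le_of_norm_le_on_zeros hρ hp (hreg p hp)
    (ContDiff.sum fun i _ => contDiff_levi hρ (hAs i) (hAs i))
    (contDiff_levi hρ (contDiff_secCoeff hAs hb) (contDiff_secCoeff hAs hb))
    (C := 2 ^ s * (∑ i, ‖b i p‖ ^ 2 + 1)) (by positivity) <| by
      filter_upwards [hbound] with x hx hx0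
      simp only [levi_eq_leviAt, hsec]
      exact norm_leviAt_sum_le hρ (fun ξ hξ => hpsc x hx0 ξ hξ) (hAcr x hx0) hx.le
  exact hflat.of_norm_le hρflat hK

end LeviForm

/-- Let `M ⊂ ℂⁿ` be a smooth pseudoconvex real hypersurface, `p ∈ M`,
and `L₁, …, L_s` a pointwise independent frame `V_B` of a rank-`s` subbundle
`B ⊆ T^{1,0}M`. Then `min_L ν_B(λ(L,L))(p)` over smooth sections `L` of `B` with
`L(p) ≠ 0` equals `ν_B(tr_{V_B} λ)(p)`, where `tr_{V_B} λ = Σ_{j=1}^s λ(L_j, L_j)`. -/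
theorem minNuLevi_eq_trace {n s : ℕ} (ρ : Cn n → ℝ) (hρ : ContDiff ℝ (⊤ : ℕ∞) ρ)
    (M : Set (Cn n)) (hM : M = {x | ρ x = 0}) (hreg : ∀ x ∈ M, fderiv ℝ ρ x ≠ 0)
    (hpsc : Pseudoconvex ρ M)
    (A : Fin s → Fin n → Cn n → ℂ) (hA : IsCRFrame ρ M A)
    (p : Cn n) (hp : p ∈ M) :
    minNuLevi ρ A p = nuB A (fun x => ∑ i, levi ρ (A i) (A i) x) p := by
  subst hM
  have hAs : ∀ i j, ContDiff ℝ ∞ (A i j) := fun i => (hA.1 i).1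
  have hlevi : ∀ i, ContDiff ℝ ∞ (levi ρ (A i) (A i)) := fun i =>
    contDiff_levi hρ (hAs i) (hAs i)
  have htr : ContDiff ℝ ∞ fun x => ∑ i, levi ρ (A i) (A i) x := ContDiff.sum fun i _ => hlevi i
  refine le_antisymm ?_ ?_ <;> refine ENat.forall_natCast_le_iff_le.1 fun r hr => ?_
  · rw [natCast_le_nuB_iff hAs htr]
    refine IsFlat.sum fun i _ => (natCast_le_nuB_iff hAs (hlevi i)).1 (hr.trans (sInf_le ?_))
    have hsec : secCoeff A (fun k _ => if k = i then 1 else 0) = A i := by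
      funext j x
      simp [secCoeff]
    refine ⟨fun k _ => if k = i then 1 else 0, fun k => contDiff_const, ?_, ?_⟩ <;> rw [hsec]
    exact (hA.2 p hp).ne_zero i
  · refine le_sInf ?_
    rintro _ ⟨b, hb, -, rfl⟩
    rw [natCast_le_nuB_iff hAs
      (contDiff_levi hρ (contDiff_secCoeff hAs hb) (contDiff_secCoeff hAs hb))]
    exact isFlat_levi_secCoeff hρ hreg hpsc hA.1 hp hb ((natCast_le_nuB_iff hAs htr).1 hr)
end

section
/- Let U ⊆ ℝⁿ be open, p₀ ∈ U, let X₁,…,X_r be linearly independent real-valued smooth vector fields on U, and let 𝒟 be the C^∞(U)-module of smooth vector fields generated by X₁,…,X_r. Let f, g be germs of real-valued smooth functions at p₀ with f ≥ 0 and g ≥ 0 near p₀, and let h be a germ of a complex-valued smooth function at p₀ with |h|² ≤ f·g near p₀ and f(p₀)g(p₀) = 0. Then 2·ν_𝒟(h)(p₀) ≥ ν_𝒟(f)(p₀) + ν_𝒟(g)(p₀) (with the conventions of extended arithmetic when either order is ∞). -/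
open Topology

/-- ℝⁿ as a Pi type. -/
abbrev Rn (n : ℕ) := Fin n → ℝ

/-- The action of a vector field `Y` on a function `f` : `(Y f)(x) = df_x(Y(x))`. -/
noncomputable def vfApply {n : ℕ} {E : Type*} [NormedAddCommGroup E] [NormedSpace ℝ E]
    (Y : Rn n → Rn n) (f : Rn n → E) : Rn n → E :=
  fun x => fderiv ℝ f x (Y x)

/-- `Y` belongs to the `C^∞(U)`-module `𝒟` of vector fields generated by `X₁, …, X_r`. -/
def InModule {n r : ℕ} (U : Set (Rn n)) (X : Fin r → Rn n → Rn n) (Y : Rn n → Rn n) : Prop :=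
  ∃ a : Fin r → Rn n → ℝ, (∀ j, ContDiffOn ℝ (⊤ : ℕ∞) (a j) U) ∧
    ∀ x ∈ U, Y x = ∑ j, a j x • X j x

/-- The vanishing order `ν_𝒟(f)(p)`: the smallest `m` such that some iterated derivative
`Y_m(⋯(Y_1 f)⋯)(p) ≠ 0` with all `Y_i ∈ 𝒟`; `⊤` if no such `m` exists. -/
noncomputable def vanishOrder {n r : ℕ} {E : Type*} [NormedAddCommGroup E] [NormedSpace ℝ E]
    (U : Set (Rn n)) (X : Fin r → Rn n → Rn n) (f : Rn n → E) (p : Rn n) : ℕ∞ :=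
  sInf {m : ℕ∞ | ∃ Ys : List (Rn n → Rn n), (Ys.length : ℕ∞) = m ∧
    (∀ Y ∈ Ys, InModule U X Y) ∧ (Ys.foldl (fun g Y => vfApply Y g) f) p ≠ 0}

theorem InModule.contDiffOn {n r : ℕ} {U : Set (Rn n)} {X : Fin r → Rn n → Rn n}
    (hX : ∀ j, ContDiffOn ℝ (⊤ : ℕ∞) (X j) U) {Y : Rn n → Rn n} (hY : InModule U X Y) :
    ContDiffOn ℝ (⊤ : ℕ∞) Y U := by
  obtain ⟨a, ha, hYa⟩ := hY
  exact (ContDiffOn.sum fun j _ => (ha j).smul (hX j)).congr hYa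

theorem contDiffOn_vfApply {n : ℕ} {E : Type*} [NormedAddCommGroup E] [NormedSpace ℝ E]
    {U : Set (Rn n)} (hU : IsOpen U) {Y : Rn n → Rn n} {F : Rn n → E}
    (hY : ContDiffOn ℝ (⊤ : ℕ∞) Y U) (hF : ContDiffOn ℝ (⊤ : ℕ∞) F U) :
    ContDiffOn ℝ (⊤ : ℕ∞) (vfApply Y F) U :=
  (hF.fderiv_of_isOpen hU (by simp)).clm_apply hY

theorem contDiffOn_iterate_vfApply {n : ℕ} {E : Type*} [NormedAddCommGroup E] [NormedSpace ℝ E]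
    {U : Set (Rn n)} (hU : IsOpen U) {Y : Rn n → Rn n} {F : Rn n → E}
    (hY : ContDiffOn ℝ (⊤ : ℕ∞) Y U) (hF : ContDiffOn ℝ (⊤ : ℕ∞) F U) (k : ℕ) :
    ContDiffOn ℝ (⊤ : ℕ∞) ((vfApply Y)^[k] F) U := by
  induction k generalizing F with
  | zero => exact hF
  | succ k ih => exact ih (contDiffOn_vfApply hU hY hF)

/-- The curve `γ` is an integral curve of `Y` on `[0, ε]` that stays in `K`. -/
def IsConfinedCurve {n : ℕ} (K : Set (Rn n)) (Y : Rn n → Rn n) (ε : ℝ) (γ : ℝ → Rn n) : Prop :=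
  ∀ t ∈ Set.Icc 0 ε, HasDerivWithinAt γ (Y (γ t)) (Set.Icc 0 ε) t ∧ γ t ∈ K

theorem IsConfinedCurve.hasDerivWithinAt_comp {n : ℕ} {E : Type*} [NormedAddCommGroup E]
    [NormedSpace ℝ E] {U K : Set (Rn n)} (hU : IsOpen U) (hKU : K ⊆ U) {Y : Rn n → Rn n}
    {F : Rn n → E} (hF : ContDiffOn ℝ (⊤ : ℕ∞) F U) {ε : ℝ} {γ : ℝ → Rn n}
    (hγ : IsConfinedCurve K Y ε γ) {t : ℝ} (ht : t ∈ Set.Icc 0 ε) :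
    HasDerivWithinAt (fun t => F (γ t)) (vfApply Y F (γ t)) (Set.Icc 0 ε) t := by
  have hd : DifferentiableAt ℝ F (γ t) :=
    (hF.differentiableOn (by simp)).differentiableAt (hU.mem_nhds (hKU (hγ t ht).2))
  exact hd.hasFDerivAt.comp_hasDerivWithinAt t (hγ t ht).1

/-- Taylor's formula along an integral curve. -/
theorem IsConfinedCurve.norm_sub_taylor_le {n : ℕ} {E : Type*} [NormedAddCommGroup E]
    [NormedSpace ℝ E] {U K : Set (Rn n)} (hU : IsOpen U) (hKU : K ⊆ U) {Y : Rn n → Rn n}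
    (hY : ContDiffOn ℝ (⊤ : ℕ∞) Y U) {ε : ℝ} {γ : ℝ → Rn n} (hγ : IsConfinedCurve K Y ε γ)
    {M : ℝ} (hM0 : 0 ≤ M) (N : ℕ) {F : Rn n → E} (hF : ContDiffOn ℝ (⊤ : ℕ∞) F U)
    (hM : ∀ x ∈ K, ‖(vfApply Y)^[N] F x‖ ≤ M) {τ : ℝ} (hτ : τ ∈ Set.Icc 0 ε) :
    ‖F (γ τ) - ∑ k ∈ Finset.range N, (τ ^ k / k.factorial) • (vfApply Y)^[k] F (γ 0)‖
      ≤ M * τ ^ N := by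
  induction N generalizing F τ with
  | zero => simpa using hM _ (hγ τ hτ).2
  | succ N ih =>
    have hsub : Set.Icc 0 τ ⊆ Set.Icc 0 ε := Set.Icc_subset_Icc_right hτ.2
    have hpow : ∀ (k : ℕ) (t : ℝ), HasDerivAt (fun t : ℝ => t ^ (k + 1) / ((k + 1).factorial : ℝ))
        (t ^ k / (k.factorial : ℝ)) t := by
      intro k t
      have := (hasDerivAt_pow (k + 1) t).div_const ((k + 1).factorial : ℝ)
      refine this.congr_deriv ?_
      rw [Nat.factorial_succ, Nat.add_sub_cancel, Nat.cast_mul]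
      exact mul_div_mul_left _ _ (by positivity)
    have hder : ∀ t ∈ Set.Icc 0 τ, HasDerivWithinAt
        (fun t => F (γ t) - ∑ k ∈ Finset.range (N + 1),
          (t ^ k / (k.factorial : ℝ)) • (vfApply Y)^[k] F (γ 0))
        (vfApply Y F (γ t) - ∑ k ∈ Finset.range N,
          (t ^ k / (k.factorial : ℝ)) • (vfApply Y)^[k] (vfApply Y F) (γ 0))
        (Set.Icc 0 τ) t := by
      intro t ht
      refine ((hγ.hasDerivWithinAt_comp hU hKU hF (hsub ht)).mono hsub).sub ?_
      simp only [Finset.sum_range_succ', pow_zero, Function.iterate_succ_apply]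
      refine HasDerivWithinAt.add_const _ (HasDerivWithinAt.fun_sum fun k _ => ?_)
      exact ((hpow k t).hasDerivWithinAt).smul_const _
    have := norm_image_sub_le_of_norm_deriv_le_segment' hder (C := M * τ ^ N)
      (fun t ht => (ih (contDiffOn_vfApply hU hY hF) hM
        (hsub (Set.Ico_subset_Icc_self ht))).trans (by
          have := ht.1
          have := ht.2.le
          gcongr)) τ ⟨hτ.1, le_rfl⟩
    simp only [Finset.sum_range_succ' _ N] at this ⊢
    simpa [pow_succ, mul_assoc] using this

/-- Local integral curves of a smooth vector field exist for a uniform time and stay close. -/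
theorem exists_isConfinedCurve {n : ℕ} {U : Set (Rn n)} (hU : IsOpen U) {p : Rn n} (hp : p ∈ U)
    {ρ : ℝ} (hρ : 0 < ρ) {Y : Rn n → Rn n} (hY : ContDiffOn ℝ (⊤ : ℕ∞) Y U) :
    ∃ s > 0, ∃ δ > 0, ∀ q ∈ Metric.closedBall p s, ∀ ε ≤ δ, ∃ γ : ℝ → Rn n,
      γ 0 = q ∧ IsConfinedCurve (Metric.closedBall p ρ) Y ε γ := by
  have hYp : ContDiffAt ℝ 1 Y p := (hY.contDiffAt (hU.mem_nhds hp)).of_le (by simp)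
  obtain ⟨T, hT, a, s, L, K, hs, hpl⟩ := IsPicardLindelof.of_contDiffAt_one hYp
  obtain ⟨α, hα, hcont⟩ :=
    (hpl 0).exists_forall_mem_closedBall_eq_hasDerivWithinAt_continuousOn
  have hs' : (0 : ℝ) < s := hs
  have hp0 : (p, (0 : ℝ)) ∈ Metric.closedBall p (s : ℝ) ×ˢ Set.Icc (0 - T) (0 + T) :=
    ⟨Metric.mem_closedBall_self hs'.le, by constructor <;> linarith⟩
  have hnear := (hcont _ hp0).preimage_mem_nhdsWithin (t := Metric.closedBall p ρ) (by
    rw [(hα p hp0.1).1]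
    exact Metric.closedBall_mem_nhds p hρ)
  obtain ⟨δ, hδ, hsub⟩ := Metric.mem_nhdsWithin_iff.mp hnear
  refine ⟨min s (δ / 2), by positivity, min T (δ / 2), by positivity, fun q hq ε hε => ?_⟩
  have hqs : q ∈ Metric.closedBall p (s : ℝ) :=
    Metric.closedBall_subset_closedBall (min_le_left _ _) hq
  refine ⟨fun t => α (q, t), (hα q hqs).1, fun t ht => ?_⟩
  have hεT : ε ≤ T := hε.trans (min_le_left _ _)
  have hsubT : Set.Icc 0 ε ⊆ Set.Icc (0 - T) (0 + T) :=
    Set.Icc_subset_Icc (by linarith) (by linarith)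
  refine ⟨((hα q hqs).2 t (hsubT ht)).mono hsubT, hsub ⟨?_, hqs, hsubT ht⟩⟩
  rw [Metric.mem_ball, Prod.dist_eq]
  refine max_lt ?_ ?_
  · have := (Metric.mem_closedBall.mp hq).trans (min_le_right _ _)
    simp only
    linarith
  · have := hε.trans (min_le_right _ _)
    simp only [Real.dist_eq, sub_zero]
    rw [abs_of_nonneg ht.1]
    linarith [ht.2]

/-- The points reached from `p` by following successively integral curves (inside `K`) of the
vector fields in the list, the last one first, each for a time at most `ε`. -/
def reachable {n : ℕ} (K : Set (Rn n)) (p : Rn n) (ε : ℝ) :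
    List (Rn n → Rn n) → Set (Rn n)
  | [] => {p}
  | Y :: L => {q | ∃ γ : ℝ → Rn n, γ 0 ∈ reachable K p ε L ∧ IsConfinedCurve K Y ε γ ∧
      ∃ t ∈ Set.Icc 0 ε, γ t = q}

theorem reachable_subset {n : ℕ} {K : Set (Rn n)} {p : Rn n} (hp : p ∈ K) (ε : ℝ)
    (L : List (Rn n → Rn n)) : reachable K p ε L ⊆ K := by
  cases L with
  | nil => exact Set.singleton_subset_iff.mpr hp
  | cons Y L =>
    rintro q ⟨γ, -, hγ, t, ht, rfl⟩
    exact (hγ t ht).2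

/-- `F` is `O(ε ^ κ)` on the sets of points reachable in time `ε` along fields of the module. -/
def IsBigOReachable {n r : ℕ} {E : Type*} [NormedAddCommGroup E] (U : Set (Rn n))
    (X : Fin r → Rn n → Rn n) (K : Set (Rn n)) (p : Rn n) (F : Rn n → E) (κ : ℝ) : Prop :=
  ∀ L : List (Rn n → Rn n), (∀ Y ∈ L, InModule U X Y) → ∃ C, 0 ≤ C ∧
    ∀ᶠ ε in 𝓝[>] (0 : ℝ), ∀ q ∈ reachable K p ε L, ‖F q‖ ≤ C * ε ^ κ

theorem isBigOReachable_of_foldl_eq_zero {n r : ℕ} {E : Type*} [NormedAddCommGroup E]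
    [NormedSpace ℝ E] {U : Set (Rn n)} (hU : IsOpen U) {X : Fin r → Rn n → Rn n}
    (hX : ∀ j, ContDiffOn ℝ (⊤ : ℕ∞) (X j) U) {K : Set (Rn n)} (hK : IsCompact K) (hKU : K ⊆ U)
    {p : Rn n} (hp : p ∈ K) {F : Rn n → E} (hF : ContDiffOn ℝ (⊤ : ℕ∞) F U) (a : ℕ)
    (hvan : ∀ Ys : List (Rn n → Rn n), Ys.length < a → (∀ Y ∈ Ys, InModule U X Y) →
      (Ys.foldl (fun g Y => vfApply Y g) F) p = 0) :
    IsBigOReachable U X K p F a := by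
  intro L hL
  induction L generalizing a F with
  | nil =>
    refine ⟨‖F p‖, norm_nonneg _, Filter.Eventually.of_forall fun ε q hq => ?_⟩
    obtain rfl : q = p := hq
    cases a with
    | zero => simp
    | succ a =>
      have : F q = 0 := hvan [] (by simp) (by simp)
      simp [this]
  | cons Y L ih =>
    have hYmod : InModule U X Y := hL Y (by simp)
    have hLmod : ∀ Z ∈ L, InModule U X Z := fun Z hZ => hL Z (by simp [hZ])
    induction a generalizing F with
    | zero =>
      obtain ⟨C, hC⟩ := hK.exists_bound_of_continuousOn (hF.continuousOn.mono hKU)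
      refine ⟨C, (norm_nonneg _).trans (hC p hp), Filter.Eventually.of_forall fun ε q hq => ?_⟩
      simpa using hC q (reachable_subset hp ε _ hq)
    | succ a iha =>
      obtain ⟨C₁, hC₁0, hC₁⟩ := iha (contDiffOn_vfApply hU (hYmod.contDiffOn hX) hF)
        (fun Ys hlen hYs => hvan (Y :: Ys) (by simpa using hlen)
          (by simpa using ⟨hYmod, hYs⟩))
      obtain ⟨C₂, hC₂0, hC₂⟩ := ih hF (a + 1) hvan hLmod
      refine ⟨C₁ + C₂, by positivity, ?_⟩
      filter_upwards [hC₁, hC₂, self_mem_nhdsWithin] with ε h₁ h₂ hε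
      rintro q ⟨γ, hγ0, hγ, t, ht, rfl⟩
      have hε0 : 0 < ε := hε
      have hmv := norm_image_sub_le_of_norm_deriv_le_segment'
        (fun s hs => hγ.hasDerivWithinAt_comp hU hKU hF hs) (C := C₁ * ε ^ (a : ℝ))
        (fun s hs => h₁ _ ⟨γ, hγ0, hγ, s, Set.Ico_subset_Icc_self hs, rfl⟩) t ht
      have h0 := h₂ _ hγ0
      have ht' : C₁ * ε ^ (a : ℝ) * (t - 0) ≤ C₁ * ε ^ (a : ℝ) * ε := by
        have := ht.2
        gcongr
        linarith
      calc ‖F (γ t)‖ ≤ ‖F (γ t) - F (γ 0)‖ + ‖F (γ 0)‖ := norm_le_norm_sub_add _ _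
        _ ≤ C₁ * ε ^ (a : ℝ) * ε + C₂ * ε ^ ((a + 1 : ℕ) : ℝ) := add_le_add (hmv.trans ht') h0
        _ = (C₁ + C₂) * ε ^ ((a + 1 : ℕ) : ℝ) := by
          simp only [Real.rpow_natCast]
          ring

/-- A quadrature formula extracting the linear coefficient of a polynomial of degree less
than `N`. -/
theorem exists_weights_linear_coeff (N : ℕ) (hN : 1 < N) : ∃ s w : Fin N → ℝ,
    (∀ j, s j ∈ Set.Icc (0 : ℝ) 1) ∧ ∀ k < N, ∑ j, w j * s j ^ k = if k = 1 then 1 else 0 := by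
  let s : Fin N → ℝ := fun j => j / N
  have hinj : Function.Injective s := by
    intro i j hij
    have hN0 : (N : ℝ) ≠ 0 := by positivity
    have : (i : ℝ) = j := by simpa [s, hN0, div_left_inj'] using hij
    exact Fin.ext (by exact_mod_cast this)
  have hunit : IsUnit (Matrix.vandermonde s) :=
    (Matrix.isUnit_iff_isUnit_det _).mpr (Matrix.det_vandermonde_ne_zero_iff.mpr hinj).isUnit
  obtain ⟨w, hw⟩ := Matrix.vecMul_surjective_iff_isUnit.mpr hunit
    (fun k : Fin N => if (k : ℕ) = 1 then 1 else 0)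
  refine ⟨s, w, fun j => ⟨by positivity, ?_⟩, fun k hk => ?_⟩
  · exact div_le_one_of_le₀ (by exact_mod_cast j.2.le) (by positivity)
  · simpa [Matrix.vecMul, dotProduct, Matrix.vandermonde_apply] using congrFun hw ⟨k, hk⟩

theorem eventually_reachable_subset_closedBall {n r : ℕ} {U : Set (Rn n)} (hU : IsOpen U)
    {X : Fin r → Rn n → Rn n} (hX : ∀ j, ContDiffOn ℝ (⊤ : ℕ∞) (X j) U) {K : Set (Rn n)}
    (hK : IsCompact K) (hKU : K ⊆ U) {p : Rn n} (hp : p ∈ K) {s : ℝ} (hs : 0 < s)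
    {L : List (Rn n → Rn n)} (hL : ∀ Y ∈ L, InModule U X Y) :
    ∀ᶠ ε in 𝓝[>] (0 : ℝ), reachable K p ε L ⊆ Metric.closedBall p s := by
  obtain ⟨C, -, hC⟩ := isBigOReachable_of_foldl_eq_zero hU hX hK hKU hp
    (F := fun x => x - p) (contDiffOn_id.sub contDiffOn_const) 1
    (fun Ys hlen _ => by
      obtain rfl : Ys = [] := List.length_eq_zero_iff.mp (by omega)
      simp) L hL
  have hlim : Filter.Tendsto (fun ε : ℝ => C * ε) (𝓝[>] 0) (𝓝 0) := by
    have : Filter.Tendsto (fun ε : ℝ => C * ε) (𝓝 0) (𝓝 (C * 0)) :=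
      (continuous_const.mul continuous_id).tendsto 0
    rw [mul_zero] at this
    exact this.mono_left nhdsWithin_le_nhds
  filter_upwards [hC, hlim.eventually (gt_mem_nhds hs)] with ε h₁ h₂ q hq
  have := h₁ q hq
  rw [mem_closedBall_iff_norm]
  simp only [Nat.cast_one, Real.rpow_one] at this
  linarith

theorem IsBigOReachable.vfApply {n r : ℕ} {E : Type*} [NormedAddCommGroup E]
    [NormedSpace ℝ E] {U : Set (Rn n)} (hU : IsOpen U) {X : Fin r → Rn n → Rn n}
    (hX : ∀ j, ContDiffOn ℝ (⊤ : ℕ∞) (X j) U) {p : Rn n} {ρ : ℝ} (hρ : 0 < ρ)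
    (hKU : Metric.closedBall p ρ ⊆ U) {F : Rn n → E} (hF : ContDiffOn ℝ (⊤ : ℕ∞) F U) {κ : ℝ}
    (h : IsBigOReachable U X (Metric.closedBall p ρ) p F κ) {Y : Rn n → Rn n}
    (hYmod : InModule U X Y) :
    IsBigOReachable U X (Metric.closedBall p ρ) p (vfApply Y F) (κ - 1) := by
  intro L hL
  have hp : p ∈ Metric.closedBall p ρ := Metric.mem_closedBall_self hρ.le
  have hK : IsCompact (Metric.closedBall p ρ) := isCompact_closedBall p ρ
  have hY := hYmod.contDiffOn hX
  obtain ⟨N₀, hN₀⟩ := exists_nat_ge κ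
  obtain ⟨N, hN1, hNκ⟩ : ∃ N : ℕ, 1 < N ∧ κ ≤ N :=
    ⟨N₀ + 2, by omega, hN₀.trans (by push_cast; linarith)⟩
  obtain ⟨M, hM⟩ := hK.exists_bound_of_continuousOn
    ((contDiffOn_iterate_vfApply hU hY hF N).continuousOn.mono hKU)
  have hM0 : 0 ≤ M := (norm_nonneg _).trans (hM p hp)
  obtain ⟨C, hC0, hC⟩ := h (Y :: L) (by simpa using ⟨hYmod, hL⟩)
  obtain ⟨σ, hσ, δ, hδ, hcurve⟩ := exists_isConfinedCurve hU (hKU hp) hρ hY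
  obtain ⟨s, w, hs, hw⟩ := exists_weights_linear_coeff N hN1
  refine ⟨∑ j, |w j| * (C + M), by positivity, ?_⟩
  filter_upwards [hC, self_mem_nhdsWithin, nhdsWithin_le_nhds (gt_mem_nhds hδ),
    nhdsWithin_le_nhds (gt_mem_nhds one_pos),
    eventually_reachable_subset_closedBall hU hX hK hKU hp hσ hL] with ε h₁ hε hεδ hε1 hball q hq
  have hε0 : 0 < ε := hε
  obtain ⟨γ, rfl, hγ⟩ := hcurve q (hball hq) ε hεδ.le
  have hτ : ∀ j, s j * ε ∈ Set.Icc 0 ε := fun j =>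
    ⟨mul_nonneg (hs j).1 hε0.le, mul_le_of_le_one_left hε0.le (hs j).2⟩
  have hκ : ε ^ (N : ℝ) ≤ ε ^ κ := Real.rpow_le_rpow_of_exponent_ge hε0 hε1.le hNκ
  have hsum : ∑ j, w j • ∑ k ∈ Finset.range N,
      ((s j * ε) ^ k / (k.factorial : ℝ)) • (_root_.vfApply Y)^[k] F (γ 0)
      = ε • _root_.vfApply Y F (γ 0) := by
    simp only [Finset.smul_sum]
    rw [Finset.sum_comm]
    have : ∀ k ∈ Finset.range N, ∑ j, w j • ((s j * ε) ^ k / (k.factorial : ℝ)) •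
        (_root_.vfApply Y)^[k] F (γ 0) =
        if k = 1 then ε • _root_.vfApply Y F (γ 0) else 0 := by
      intro k hk
      have h₂ := hw k (Finset.mem_range.mp hk)
      have h₃ : ∀ j, w j * ((s j * ε) ^ k / (k.factorial : ℝ)) =
          (w j * s j ^ k) * (ε ^ k / (k.factorial : ℝ)) := fun j => by ring
      simp only [smul_smul, h₃]
      rw [← Finset.sum_smul, ← Finset.sum_mul, h₂]
      split_ifs with h1
      · subst h1
        simp
      · simp
    rw [Finset.sum_congr rfl this, Finset.sum_ite_eq']
    simp [hN1]
  have hterm : ∀ j, ‖∑ k ∈ Finset.range N,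
      ((s j * ε) ^ k / (k.factorial : ℝ)) • (_root_.vfApply Y)^[k] F (γ 0)‖ ≤
      (C + M) * ε ^ κ := by
    intro j
    have hT := hγ.norm_sub_taylor_le hU hKU hY hM0 N hF hM (hτ j)
    have hv := h₁ (γ (s j * ε)) ⟨γ, hq, hγ, _, hτ j, rfl⟩
    have hpow : M * (s j * ε) ^ N ≤ M * ε ^ κ := by
      rw [← Real.rpow_natCast]
      refine mul_le_mul_of_nonneg_left (le_trans ?_ hκ) hM0
      exact Real.rpow_le_rpow (hτ j).1 (hτ j).2 (by positivity)
    have := norm_le_norm_add_norm_sub (F (γ (s j * ε))) (∑ k ∈ Finset.range N,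
      ((s j * ε) ^ k / (k.factorial : ℝ)) • (_root_.vfApply Y)^[k] F (γ 0))
    linarith
  have hfin : ε * ‖_root_.vfApply Y F (γ 0)‖ ≤ (∑ j, |w j| * (C + M)) * ε ^ κ := by
    rw [← abs_of_pos hε0, ← Real.norm_eq_abs, ← norm_smul, Real.norm_eq_abs, abs_of_pos hε0,
      ← hsum, Finset.sum_mul]
    refine (norm_sum_le _ _).trans (Finset.sum_le_sum fun j _ => ?_)
    rw [norm_smul, Real.norm_eq_abs, mul_assoc]
    exact mul_le_mul_of_nonneg_left (hterm j) (abs_nonneg _)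
  rw [Real.rpow_sub_one hε0.ne', ← mul_div_assoc, le_div_iff₀ hε0]
  linarith

theorem IsBigOReachable.foldl_vfApply_eq_zero {n r : ℕ} {E : Type*} [NormedAddCommGroup E]
    [NormedSpace ℝ E] {U : Set (Rn n)} (hU : IsOpen U) {X : Fin r → Rn n → Rn n}
    (hX : ∀ j, ContDiffOn ℝ (⊤ : ℕ∞) (X j) U) {p : Rn n} {ρ : ℝ} (hρ : 0 < ρ)
    (hKU : Metric.closedBall p ρ ⊆ U) {F : Rn n → E} (hF : ContDiffOn ℝ (⊤ : ℕ∞) F U) {κ : ℝ}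
    (h : IsBigOReachable U X (Metric.closedBall p ρ) p F κ) {Ys : List (Rn n → Rn n)}
    (hYs : ∀ Y ∈ Ys, InModule U X Y) (hlen : (Ys.length : ℝ) < κ) :
    (Ys.foldl (fun g Y => _root_.vfApply Y g) F) p = 0 := by
  induction Ys generalizing F κ with
  | nil =>
    obtain ⟨C, -, hC⟩ := h [] (by simp)
    have hκ : 0 < κ := by simpa using hlen
    have hlim : Filter.Tendsto (fun ε : ℝ => C * ε ^ κ) (𝓝[>] 0) (𝓝 0) := by
      have := ((Real.continuousAt_rpow_const 0 κ (Or.inr hκ.le)).tendsto).const_mul C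
      rw [Real.zero_rpow hκ.ne', mul_zero] at this
      exact this.mono_left nhdsWithin_le_nhds
    have hle : ‖F p‖ ≤ 0 := ge_of_tendsto hlim (hC.mono fun ε hε => hε p rfl)
    exact norm_le_zero_iff.mp hle
  | cons Y Ys ih =>
    have hY : InModule U X Y := hYs Y (by simp)
    refine ih (contDiffOn_vfApply hU (hY.contDiffOn hX) hF) (h.vfApply hU hX hρ hKU hF hY)
      (fun Z hZ => hYs Z (by simp [hZ])) ?_
    push_cast [List.length_cons] at hlen
    linarith

theorem isBigOReachable_of_norm_sq_le {n r : ℕ} {E : Type*} [NormedAddCommGroup E]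
    {U : Set (Rn n)} {X : Fin r → Rn n → Rn n} {K : Set (Rn n)} {p : Rn n} (hp : p ∈ K)
    {f g : Rn n → ℝ} {h : Rn n → E} (hle : ∀ x ∈ K, ‖h x‖ ^ 2 ≤ f x * g x) {a b : ℝ}
    (hf : IsBigOReachable U X K p f a) (hg : IsBigOReachable U X K p g b) :
    IsBigOReachable U X K p h ((a + b) / 2) := by
  intro L hL
  obtain ⟨C₁, hC₁, h₁⟩ := hf L hL
  obtain ⟨C₂, hC₂, h₂⟩ := hg L hL
  refine ⟨√(C₁ * C₂), Real.sqrt_nonneg _, ?_⟩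
  filter_upwards [h₁, h₂, self_mem_nhdsWithin] with ε h₁ h₂ hε q hq
  have hε0 : 0 < ε := hε
  refine (sq_le_sq₀ (norm_nonneg _) (by positivity)).mp ?_
  calc ‖h q‖ ^ 2 ≤ f q * g q := hle q (reachable_subset hp ε L hq)
    _ ≤ ‖f q‖ * ‖g q‖ := by rw [← norm_mul]; exact Real.le_norm_self _
    _ ≤ (C₁ * ε ^ a) * (C₂ * ε ^ b) := by
      gcongr
      · exact h₁ q hq
      · exact h₂ q hq
    _ = (√(C₁ * C₂) * ε ^ ((a + b) / 2)) ^ 2 := by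
      rw [mul_pow, Real.sq_sqrt (by positivity), ← Real.rpow_natCast (ε ^ _),
        ← Real.rpow_mul hε0.le]
      have : (a + b) / 2 * ((2 : ℕ) : ℝ) = a + b := by push_cast; ring
      rw [this, Real.rpow_add hε0]
      ring

theorem foldl_vfApply_eq_zero_of_lt_vanishOrder {n r : ℕ} {E : Type*} [NormedAddCommGroup E]
    [NormedSpace ℝ E] {U : Set (Rn n)} {X : Fin r → Rn n → Rn n} {f : Rn n → E} {p : Rn n}
    {Ys : List (Rn n → Rn n)} (hYs : ∀ Y ∈ Ys, InModule U X Y)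
    (hlt : (Ys.length : ℕ∞) < vanishOrder U X f p) :
    (Ys.foldl (fun g Y => vfApply Y g) f) p = 0 := by
  by_contra hne
  exact hlt.not_ge (sInf_le ⟨Ys, rfl, hYs, hne⟩)

theorem exists_foldl_vfApply_ne_zero {n r : ℕ} {E : Type*} [NormedAddCommGroup E]
    [NormedSpace ℝ E] {U : Set (Rn n)} {X : Fin r → Rn n → Rn n} {f : Rn n → E} {p : Rn n}
    (hfin : vanishOrder U X f p ≠ ⊤) :
    ∃ Ys : List (Rn n → Rn n), (Ys.length : ℕ∞) = vanishOrder U X f p ∧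
      (∀ Y ∈ Ys, InModule U X Y) ∧ (Ys.foldl (fun g Y => vfApply Y g) f) p ≠ 0 := by
  refine csInf_mem (s := {m : ℕ∞ | ∃ Ys : List (Rn n → Rn n), (Ys.length : ℕ∞) = m ∧
    (∀ Y ∈ Ys, InModule U X Y) ∧ (Ys.foldl (fun g Y => vfApply Y g) f) p ≠ 0}) ?_
  by_contra hempty
  rw [Set.not_nonempty_iff_eq_empty] at hempty
  exact hfin (by rw [vanishOrder, hempty, sInf_empty])

theorem ENat.exists_natCast_le_of_lt_add {m : ℕ} {x y : ℕ∞} (h : (m : ℕ∞) < x + y) :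
    ∃ a b : ℕ, (a : ℕ∞) ≤ x ∧ (b : ℕ∞) ≤ y ∧ m < a + b := by
  induction x using ENat.recTopCoe with
  | top => exact ⟨m + 1, 0, le_top, by simp, by omega⟩
  | coe a =>
    induction y using ENat.recTopCoe with
    | top => exact ⟨0, m + 1, by simp, le_top, by omega⟩
    | coe b => exact ⟨a, b, le_rfl, le_rfl, by exact_mod_cast h⟩

/-- If `f, g ≥ 0` near `p₀`, `h` is complex-valued with `|h|² ≤ f·g` near
`p₀`, and `f(p₀)g(p₀) = 0`, then `2·ν_𝒟(h)(p₀) ≥ ν_𝒟(f)(p₀) + ν_𝒟(g)(p₀)`. -/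
theorem vanishOrder_schwarz {n r : ℕ} (U : Set (Rn n)) (hU : IsOpen U) (p₀ : Rn n)
    (hp₀ : p₀ ∈ U)
    (X : Fin r → Rn n → Rn n) (hX : ∀ j, ContDiffOn ℝ (⊤ : ℕ∞) (X j) U)
    (hind : ∀ x ∈ U, LinearIndependent ℝ (fun j => X j x))
    (f g : Rn n → ℝ) (h : Rn n → ℂ)
    (hf : ContDiffOn ℝ (⊤ : ℕ∞) f U) (hg : ContDiffOn ℝ (⊤ : ℕ∞) g U)
    (hh : ContDiffOn ℝ (⊤ : ℕ∞) h U)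
    (hfpos : ∀ᶠ x in 𝓝 p₀, 0 ≤ f x) (hgpos : ∀ᶠ x in 𝓝 p₀, 0 ≤ g x)
    (hsch : ∀ᶠ x in 𝓝 p₀, ‖h x‖ ^ 2 ≤ f x * g x) (h0 : f p₀ * g p₀ = 0) :
    vanishOrder U X f p₀ + vanishOrder U X g p₀ ≤ 2 * vanishOrder U X h p₀ := by
  by_contra! hlt
  have hfin : vanishOrder U X h p₀ ≠ ⊤ := by
    intro htop
    simp [htop] at hlt
  obtain ⟨Ys, hlen, hYs, hne⟩ := exists_foldl_vfApply_ne_zero hfin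
  rw [← hlen] at hlt
  obtain ⟨a, b, ha, hb, hab⟩ :=
    ENat.exists_natCast_le_of_lt_add (m := 2 * Ys.length) (by exact_mod_cast hlt)
  obtain ⟨ρ, hρ, hball⟩ := Metric.nhds_basis_closedBall.mem_iff.mp
    (Filter.inter_mem (hU.mem_nhds hp₀) hsch)
  have hKU : Metric.closedBall p₀ ρ ⊆ U := fun x hx => (hball hx).1
  have hp : p₀ ∈ Metric.closedBall p₀ ρ := Metric.mem_closedBall_self hρ.le
  have hK := isCompact_closedBall p₀ ρ
  have hF := isBigOReachable_of_foldl_eq_zero hU hX hK hKU hp hf a fun Zs hl hZs =>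
    foldl_vfApply_eq_zero_of_lt_vanishOrder hZs ((Nat.cast_lt.mpr hl).trans_le ha)
  have hG := isBigOReachable_of_foldl_eq_zero hU hX hK hKU hp hg b fun Zs hl hZs =>
    foldl_vfApply_eq_zero_of_lt_vanishOrder hZs ((Nat.cast_lt.mpr hl).trans_le hb)
  have hH := isBigOReachable_of_norm_sq_le hp (fun x hx => (hball hx).2) hF hG
  refine hne (hH.foldl_vfApply_eq_zero hU hX hρ hKU hh hYs ?_)
  have : (2 * Ys.length : ℝ) < a + b := by exact_mod_cast hab
  linarith
end
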